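/- arXiv:2005.01918 — 17 statements merged into one kernel-verified Lean document; each statement's English description precedes it below -/
import Mathlib

section
/- Let f : ℝ² → ℝ be continuous with compact support, let ψ be a unit vector in ℝ², and let F_ψ(t) = ∫_{⟨x,ψ⟩ ≤ t} f(x) dx be the half-plane transform of f. Then for every t ∈ ℝ, F_ψ is differentiable at t and its derivative equals the Radon transform of f: dF_ψ(t)/dt = Rf(ψ, t). -/
open MeasureTheory Real

/-- Euclidean inner product on ℝ². -/
def dot (u v : ℝ × ℝ) : ℝ := u.1 * v.1 + u.2 * v.2

/-- The divergent beam transform `X_γ f (x) = ∫_0^∞ f (x + tγ) dt`. -/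
noncomputable def divBeam (γ : ℝ × ℝ) (f : ℝ × ℝ → ℝ) (x : ℝ × ℝ) : ℝ :=
  ∫ t in Set.Ioi (0 : ℝ), f (x + t • γ)

/-- The Radon transform `R g (ψ, t) = ∫_ℝ g (tψ + sψ⊥) ds`, where `ψ⊥` is `ψ` rotated by π/2. -/
noncomputable def radon (g : ℝ × ℝ → ℝ) (ψ : ℝ × ℝ) (t : ℝ) : ℝ :=
  ∫ s : ℝ, g (t • ψ + s • (-ψ.2, ψ.1))

/-- The half-plane transform `F_ψ (t) = ∫_{⟨x,ψ⟩ ≤ t} f (x) dx`. -/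
noncomputable def halfPlane (f : ℝ × ℝ → ℝ) (ψ : ℝ × ℝ) (t : ℝ) : ℝ :=
  ∫ x in {x : ℝ × ℝ | dot x ψ ≤ t}, f x

theorem halfPlane_hasDerivAt_radon (f : ℝ × ℝ → ℝ)
    (hf : Continuous f) (hsupp : HasCompactSupport f)
    (ψ : ℝ × ℝ) (hψ : ψ.1 ^ 2 + ψ.2 ^ 2 = 1) (t : ℝ) :
    HasDerivAt (halfPlane f ψ) (radon f ψ t) t := by
  -- rotation as a homeomorphism
  let T : (ℝ × ℝ) ≃ₜ (ℝ × ℝ) :=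
    { toFun := fun p => p.1 • ψ + p.2 • (-ψ.2, ψ.1)
      invFun := fun x => (x.1 * ψ.1 + x.2 * ψ.2, -x.1 * ψ.2 + x.2 * ψ.1)
      left_inv := by
        intro p
        ext
        · simp
          linear_combination p.1 * hψ
        · simp
          linear_combination p.2 * hψ
      right_inv := by
        intro p
        ext
        · simp
          linear_combination p.1 * hψ
        · simp
          linear_combination p.2 * hψ
      continuous_toFun := by fun_prop
      continuous_invFun := by fun_prop }
  have hT : ∀ p, T p = p.1 • ψ + p.2 • (-ψ.2, ψ.1) := fun p => rfl
  have hmp : MeasurePreserving T volume volume := by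
    refine ⟨T.continuous.measurable, ?_⟩
    let L := Matrix.toLin (Module.Basis.finTwoProd ℝ) (Module.Basis.finTwoProd ℝ)
      !![ψ.1, -ψ.2; ψ.2, ψ.1]
    have hL : ⇑T = ⇑L := by
      funext p
      rw [hT, Matrix.toLin_finTwoProd_apply]
      ext
      · simp
        ring
      · simp
        ring
    have hdet : LinearMap.det L = 1 := by
      rw [LinearMap.det_toLin, Matrix.det_fin_two_of]
      linear_combination hψ
    rw [hL, Measure.map_linearMap_addHaar_eq_smul_addHaar _ (by rw [hdet]; exact one_ne_zero),
      hdet]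
    simp
  have hgc : Continuous (f ∘ T) := hf.comp T.continuous
  have hgs : HasCompactSupport (f ∘ T) := hsupp.comp_homeomorph T
  have hgi : Integrable (f ∘ T) (volume : Measure (ℝ × ℝ)) :=
    hgc.integrable_of_hasCompactSupport hgs
  have hGeq : radon f ψ = fun u => ∫ s, (f ∘ T) (u, s) := rfl
  have hGi : Integrable (radon f ψ) := by
    rw [hGeq]
    exact Integrable.integral_prod_left hgi
  have hGc : Continuous (radon f ψ) := by
    have hK : IsCompact (Prod.snd '' tsupport (f ∘ T)) := hgs.isCompact.image continuous_snd
    have : radon f ψ = fun u => ∫ s in Prod.snd '' tsupport (f ∘ T), (f ∘ T) (u, s) := by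
      rw [hGeq]
      funext u
      symm
      apply setIntegral_eq_integral_of_forall_compl_eq_zero
      intro s hs
      by_contra h
      exact hs ⟨(u, s), subset_tsupport _ h, rfl⟩
    rw [this]
    exact continuous_parametric_integral_of_continuous (f := fun u s => (f ∘ T) (u, s)) hgc hK
  have hH : ∀ u, halfPlane f ψ u = ∫ v in Set.Iic u, radon f ψ v := by
    intro u
    have hpre : T ⁻¹' {x : ℝ × ℝ | dot x ψ ≤ u} = Set.Iic u ×ˢ Set.univ := by
      ext p
      have : dot (T p) ψ = p.1 := by
        rw [hT]
        simp [dot]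
        linear_combination p.1 * hψ
      simp [this]
    rw [halfPlane, ← hmp.setIntegral_preimage_emb T.measurableEmbedding, hpre,
      Measure.volume_eq_prod, setIntegral_prod (fun x => f (T x)) hgi.integrableOn]
    simp [hGeq]
  have hH2 : halfPlane f ψ = fun u => (∫ v in Set.Iic t, radon f ψ v) +
      ∫ v in t..u, radon f ψ v := by
    funext u
    rw [hH, ← intervalIntegral.integral_Iic_sub_Iic hGi.integrableOn hGi.integrableOn]
    ring
  rw [hH2]
  exact (hGc.integral_hasStrictDerivAt t t).hasDerivAt.const_add _
end

section
/- Let f : ℝ² → ℝ be continuous with compact support, let γ and ψ be unit vectors in ℝ² with ⟨ψ,γ⟩ < 0. Then for every t ∈ ℝ, the Radon transform of the divergent beam transform satisfies R(X_γ f)(ψ, t) = −(1/⟨ψ,γ⟩) · F_ψ(t), where F_ψ(t) = ∫_{⟨x,ψ⟩ ≤ t} f(x) dx is the half-plane transform of f. -/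
open MeasureTheory Real

theorem radon_divBeam_eq_neg_inv_mul_halfPlane (f : ℝ × ℝ → ℝ)
    (hf : Continuous f) (hsupp : HasCompactSupport f)
    (γ : ℝ × ℝ) (hγ : γ.1 ^ 2 + γ.2 ^ 2 = 1)
    (ψ : ℝ × ℝ) (hψ : ψ.1 ^ 2 + ψ.2 ^ 2 = 1)
    (hneg : dot ψ γ < 0) (t : ℝ) :
    radon (divBeam γ f) ψ t = -(1 / dot ψ γ) * halfPlane f ψ t := by
  set H : Set (ℝ × ℝ) := {x | dot x ψ ≤ t} with hH
  have hHm : MeasurableSet H := by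
    apply measurableSet_le _ measurable_const
    unfold dot
    fun_prop
  set L : ℝ × ℝ →ₗ[ℝ] ℝ × ℝ :=
    Matrix.toLin (Module.Basis.finTwoProd ℝ) (Module.Basis.finTwoProd ℝ) !![-ψ.2, γ.1; ψ.1, γ.2] with hL
  have hLa : ∀ s u : ℝ, L (s, u) = s • (-ψ.2, ψ.1) + u • γ := by
    intro s u
    rw [hL, Matrix.toLin_finTwoProd_apply]
    ext <;> simp <;> ring
  have hdet : LinearMap.det L = - dot ψ γ := by
    rw [hL, LinearMap.det_toLin, Matrix.det_fin_two_of]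
    unfold dot; ring
  have hpos : 0 < - dot ψ γ := by linarith
  have hmap := Measure.map_linearMap_addHaar_eq_smul_addHaar
    (volume : Measure (ℝ × ℝ)) (f := L) (by rw [hdet]; exact hpos.ne')
  rw [hdet, abs_of_pos (inv_pos.2 hpos)] at hmap
  have hLm : Measurable L := L.continuous_of_finiteDimensional.measurable
  set h : ℝ × ℝ → ℝ := H.indicator f with hh
  have hint : Integrable h := (hf.integrable_of_hasCompactSupport hsupp).indicator hHm
  have hint2 : Integrable (fun x => h (t • ψ + x)) := hint.comp_add_left (t • ψ)
  have hint3 : Integrable (fun x => h (t • ψ + x)) (Measure.map L volume) := by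
    rw [hmap]; exact hint2.smul_measure ENNReal.ofReal_ne_top
  have hint4 : Integrable (fun p => h (t • ψ + L p)) := hint3.comp_measurable hLm
  have e1 : ∫ p, h (t • ψ + L p) = (- dot ψ γ)⁻¹ * halfPlane f ψ t := by
    rw [← integral_map (φ := L) hLm.aemeasurable hint3.aestronglyMeasurable, hmap,
      integral_smul_measure, ENNReal.toReal_ofReal (inv_pos.2 hpos).le,
      integral_add_left_eq_self, integral_indicator hHm]
    rfl
  have e2 : ∫ p, h (t • ψ + L p) = radon (divBeam γ f) ψ t := by
    rw [Measure.volume_eq_prod] at hint4 ⊢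
    rw [integral_prod _ hint4]
    unfold radon divBeam
    congr 1
    ext s
    rw [← integral_Ici_eq_integral_Ioi, ← integral_indicator measurableSet_Ici]
    congr 1
    ext u
    have hd : dot (t • ψ + L (s, u)) ψ = t + u * dot ψ γ := by
      rw [hLa]
      simp [dot]
      linear_combination t * hψ
    have hiff : t • ψ + L (s, u) ∈ H ↔ u ∈ Set.Ici (0:ℝ) := by
      rw [hH, Set.mem_setOf_eq, hd, Set.mem_Ici]
      constructor
      · intro h1; by_contra! h2; nlinarith
      · intro h1; nlinarith
    by_cases hu : u ∈ Set.Ici (0:ℝ)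
    · rw [hh, Set.indicator_of_mem (hiff.2 hu), Set.indicator_of_mem hu, hLa, add_assoc]
    · rw [hh, Set.indicator_of_notMem (fun h => hu (hiff.1 h)), Set.indicator_of_notMem hu]
  rw [← e2, e1]
  congr 1
  rw [inv_neg, one_div]
end

section
/- Let f : ℝ² → ℝ be continuous with compact support, let γ and ψ be unit vectors in ℝ² with ⟨ψ,γ⟩ ≠ 0. Then for every t ∈ ℝ, the function t ↦ R(X_γ f)(ψ, t) is differentiable at t and d/dt R(X_γ f)(ψ, t) = −(1/⟨ψ,γ⟩) · Rf(ψ, t). -/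
open MeasureTheory Real

/-- The core computation in coordinates adapted to `ψ`. -/
theorem core_aux (h : ℝ × ℝ → ℝ) (hc : Continuous h) (M : ℝ)
    (hM : ∀ a b, h (a, b) ≠ 0 → |a| ≤ M ∧ |b| ≤ M) (c d : ℝ) (hne : c ≠ 0) (t : ℝ) :
    HasDerivAt (fun u => ∫ s : ℝ, ∫ r in Set.Ioi (0 : ℝ), h (u + r * c, s + r * d))
      (-(1 / c) * ∫ s : ℝ, h (t, s)) t := by
  have hcs : HasCompactSupport h := by
    apply HasCompactSupport.intro (K := Set.Icc (-M) M ×ˢ Set.Icc (-M) M)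
      (isCompact_Icc.prod isCompact_Icc)
    rintro ⟨a, b⟩ hx
    by_contra h0
    obtain ⟨h1, h2⟩ := hM a b h0
    exact hx ⟨abs_le.1 h1, abs_le.1 h2⟩
  obtain ⟨C, hC⟩ := hcs.exists_bound_of_continuous hc
  set F : ℝ → ℝ := fun u => ∫ s : ℝ, h (u, s) with hF
  have hFc : Continuous F := by
    apply continuous_of_dominated (bound := Set.indicator (Set.Icc (-M) M) (fun _ => C))
    · intro u
      exact (hc.comp (by fun_prop)).aestronglyMeasurable
    · intro u
      refine Filter.Eventually.of_forall fun s => ?_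
      by_cases hs : s ∈ Set.Icc (-M) M
      · rw [Set.indicator_of_mem hs]; exact hC _
      · rw [Set.indicator_of_notMem hs]
        by_contra h0
        have : h (u, s) ≠ 0 := by
          intro h1; apply h0; simp [h1]
        exact hs (abs_le.1 (hM u s this).2)
    · exact (integrable_indicator_iff measurableSet_Icc).2 (by simp)
    · exact Filter.Eventually.of_forall fun s => hc.comp (by fun_prop)
  have hFs : HasCompactSupport F := by
    apply HasCompactSupport.intro (K := Set.Icc (-M) M) isCompact_Icc
    intro u hu
    have : ∀ s, h (u, s) = 0 := by
      intro s
      by_contra h0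
      exact hu (abs_le.1 (hM u s h0).1)
    simp [hF, this]
  have hFi : Integrable F := hFc.integrable_of_hasCompactSupport hFs
  -- Fubini
  have key : ∀ u, ∫ s : ℝ, ∫ r in Set.Ioi (0 : ℝ), h (u + r * c, s + r * d)
      = ∫ r in Set.Ioi (0 : ℝ), F (u + r * c) := by
    intro u
    have hint : Integrable (fun p : ℝ × ℝ => h (u + p.2 * c, p.1 + p.2 * d)) := by
      apply Continuous.integrable_of_hasCompactSupport (hc.comp (by fun_prop))
      set B := (M + |u|) / |c| with hB
      apply HasCompactSupport.intro
        (K := Set.Icc (-(M + B * |d|)) (M + B * |d|) ×ˢ Set.Icc (-B) B)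
        (isCompact_Icc.prod isCompact_Icc)
      rintro ⟨s, r⟩ hx
      by_contra h0
      obtain ⟨h1, h2⟩ := hM _ _ h0
      simp only at h1 h2
      have hr : |r| ≤ B := by
        rw [hB, le_div_iff₀ (abs_pos.2 hne), ← abs_mul]
        have := abs_sub (u + r * c) u
        rw [add_sub_cancel_left] at this
        linarith
      have hs : |s| ≤ M + B * |d| := by
        have := abs_sub (s + r * d) (r * d)
        rw [add_sub_cancel_right, abs_mul] at this
        have := mul_le_mul_of_nonneg_right hr (abs_nonneg d)
        linarith
      exact hx ⟨abs_le.1 hs, abs_le.1 hr⟩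
    have hint2 : Integrable (fun p : ℝ × ℝ => h (u + p.2 * c, p.1 + p.2 * d))
        ((volume : Measure ℝ).prod (volume.restrict (Set.Ioi (0 : ℝ)))) := by
      have e := Measure.prod_restrict (μ := (volume : Measure ℝ)) (ν := (volume : Measure ℝ))
        Set.univ (Set.Ioi (0 : ℝ))
      rw [Measure.restrict_univ] at e
      rw [e]
      exact hint.restrict
    rw [integral_integral_swap (f := fun s r => h (u + r * c, s + r * d)) hint2]
    congr 1
    ext r
    exact integral_add_right_eq_self (fun s => h (u + r * c, s)) (r * d)
  simp_rw [key]
  set G : ℝ → ℝ := fun x => ∫ y in (0 : ℝ)..x, F y with hG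
  have hGd : ∀ x, HasDerivAt G (F x) x := fun x => hFc.integral_hasStrictDerivAt 0 x |>.hasDerivAt
  have hL : ∃ L, ∀ u, Filter.Tendsto (fun r => G (u + r * c)) Filter.atTop (nhds L) := by
    rcases lt_or_gt_of_ne hne with h1 | h1
    · refine ⟨-∫ y in Set.Iic 0, F y, fun u => ?_⟩
      have h2 : Filter.Tendsto G Filter.atBot (nhds (-∫ y in Set.Iic 0, F y)) := by
        have := (intervalIntegral_tendsto_integral_Iic (f := F) (μ := volume) 0
          hFi.integrableOn Filter.tendsto_id).neg
        refine this.congr fun x => ?_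
        rw [hG, intervalIntegral.integral_symm]; simp
      exact h2.comp (Filter.tendsto_atBot_add_const_left _ _
        (Filter.tendsto_id.atTop_mul_const_of_neg h1))
    · refine ⟨∫ y in Set.Ioi 0, F y, fun u => ?_⟩
      have h2 : Filter.Tendsto G Filter.atTop (nhds (∫ y in Set.Ioi 0, F y)) :=
        intervalIntegral_tendsto_integral_Ioi (f := F) (μ := volume) 0
          hFi.integrableOn Filter.tendsto_id
      exact h2.comp (Filter.tendsto_atTop_add_const_left _ _
        (Filter.tendsto_id.atTop_mul_const h1))
  obtain ⟨L, hL⟩ := hL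
  have key2 : ∀ u, ∫ r in Set.Ioi (0 : ℝ), F (u + r * c) = L / c - G u / c := by
    intro u
    have hi : Integrable (fun r => F (u + r * c)) :=
      (hFi.comp_add_left u).comp_mul_right' hne
    have hd : ∀ r ∈ Set.Ici (0 : ℝ), HasDerivAt (fun r => G (u + r * c) / c) (F (u + r * c)) r := by
      intro r _
      have h1 : HasDerivAt (fun r : ℝ => u + r * c) c r := by
        simpa using ((hasDerivAt_id r).mul_const c).const_add u
      have h2 := ((hGd (u + r * c)).comp r h1).div_const c
      rwa [mul_div_cancel_right₀ _ hne] at h2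
    have := integral_Ioi_of_hasDerivAt_of_tendsto' hd hi.integrableOn ((hL u).div_const c)
    simpa using this
  simp_rw [key2]
  have := ((hGd t).div_const c).const_sub (L / c)
  have e : -(1 / c) * ∫ s : ℝ, h (t, s) = -(F t / c) := by
    rw [hF]; ring
  rw [e]
  exact this

theorem hasDerivAt_radon_divBeam (f : ℝ × ℝ → ℝ)
    (hf : Continuous f) (hsupp : HasCompactSupport f)
    (γ : ℝ × ℝ) (hγ : γ.1 ^ 2 + γ.2 ^ 2 = 1)
    (ψ : ℝ × ℝ) (hψ : ψ.1 ^ 2 + ψ.2 ^ 2 = 1)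
    (hne : dot ψ γ ≠ 0) (t : ℝ) :
    HasDerivAt (fun u => radon (divBeam γ f) ψ u)
      (-(1 / dot ψ γ) * radon f ψ t) t := by
  obtain ⟨B, hB⟩ := hsupp.isCompact.isBounded.exists_norm_le
  have hψ1 : |ψ.1| ≤ 1 := abs_le_one_iff_mul_self_le_one.2 (by nlinarith [sq_nonneg ψ.2])
  have hψ2 : |ψ.2| ≤ 1 := abs_le_one_iff_mul_self_le_one.2 (by nlinarith [sq_nonneg ψ.1])
  have bound : ∀ x y p q : ℝ, |x| ≤ B → |y| ≤ B → |p| ≤ 1 → |q| ≤ 1 →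
      |x * p + y * q| ≤ 2 * B := by
    intro x y p q hx hy hp hq
    have h1 := abs_add_le (x * p) (y * q)
    rw [abs_mul, abs_mul] at h1
    have h2 := mul_le_of_le_one_right (abs_nonneg x) hp
    have h3 := mul_le_of_le_one_right (abs_nonneg y) hq
    linarith
  have main := core_aux (fun p => f (p.1 • ψ + p.2 • (-ψ.2, ψ.1)))
    (hf.comp (by fun_prop)) (2 * B) (by
      intro a b h0
      have hx := hB _ (subset_tsupport f h0)
      simp only [Prod.norm_def, sup_le_iff, Real.norm_eq_abs, Prod.fst_add, Prod.snd_add,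
        Prod.smul_fst, Prod.smul_snd, smul_eq_mul] at hx
      have h1 := bound _ _ ψ.1 ψ.2 hx.1 hx.2 hψ1 hψ2
      have h2 := bound _ _ (-ψ.2) ψ.1 hx.1 hx.2 (by rwa [abs_neg]) hψ1
      constructor
      · convert h1 using 2
        linear_combination (-a) * hψ
      · convert h2 using 2
        linear_combination (-b) * hψ)
    (dot ψ γ) (-ψ.2 * γ.1 + ψ.1 * γ.2) hne t
  convert main using 1
  swap
  · rfl
  ext u
  unfold radon divBeam
  congr 1
  ext s
  congr 1
  ext r
  congr 1
  ext
  · simp [dot]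
    linear_combination (-r * γ.1) * hψ
  · simp [dot]
    linear_combination (-r * γ.2) * hψ
end

section
/- Let f : ℝ² → ℝ be continuous with compact support, let γ_1, …, γ_m be distinct unit vectors in ℝ², let c_1, …, c_m be nonzero reals, and let S f = ∑_{i=1}^m c_i X_{γ_i} f be the star transform. Let ψ be a unit vector in ℝ² such that ⟨ψ,γ_i⟩ ≠ 0 for all i and w(ψ) := ∑_{i=1}^m c_i/⟨ψ,γ_i⟩ ≠ 0, and set q(ψ) = −1/w(ψ). Then for every t ∈ ℝ, the function t ↦ R(S f)(ψ, t) is differentiable at t and Rf(ψ, t) = q(ψ) · d/dt R(S f)(ψ, t). -/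
open MeasureTheory Real

theorem cs_comp_aux (f : ℝ × ℝ → ℝ) (hsupp : HasCompactSupport f) (e L : ℝ × ℝ → ℝ × ℝ)
    (hL : Continuous L) (h : ∀ x, L (e x) = x) : HasCompactSupport (fun x => f (e x)) := by
  refine HasCompactSupport.intro (K := L '' tsupport f) (hsupp.isCompact.image hL) ?_
  intro x hx
  refine image_eq_zero_of_notMem_tsupport (fun h' => hx ⟨e x, h', h x⟩)

theorem deriv_pos_aux (G : ℝ → ℝ) (hG : Continuous G) (hGs : HasCompactSupport G) (a : ℝ)
    (ha : 0 < a) (t : ℝ) :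
    HasDerivAt (fun u => ∫ r in Set.Ioi (0 : ℝ), G (u + r * a)) (-(G t / a)) t := by
  have hint : Integrable G := hG.integrable_of_hasCompactSupport hGs
  have key : ∀ u, ∫ r in Set.Ioi (0 : ℝ), G (u + r * a)
      = a⁻¹ * ((∫ x in Set.Ioi (0 : ℝ), G x) - ∫ x in (0 : ℝ)..u, G x) := by
    intro u
    have h1 := integral_comp_mul_right_Ioi (fun x => G (u + x)) 0 ha
    rw [h1, zero_mul, smul_eq_mul]
    congr 1
    have h2 := (measurePreserving_add_left (volume : Measure ℝ) u).setIntegral_preimage_emb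
      (MeasurableEquiv.addLeft u).measurableEmbedding G (Set.Ioi u)
    have h4 : (fun x => u + x) ⁻¹' (Set.Ioi u) = Set.Ioi (0 : ℝ) := by
      ext x; simp
    rw [h4] at h2
    rw [h2]
    have h3 := intervalIntegral.integral_Ioi_sub_Ioi' (f := G) (μ := volume) (a := 0) (b := u)
      hint.integrableOn hint.integrableOn
    linarith
  rw [funext key]
  have hd : HasDerivAt (fun u => ∫ x in (0 : ℝ)..u, G x) (G t) t :=
    hG.integral_hasStrictDerivAt 0 t |>.hasDerivAt
  have := ((hd.const_sub (∫ x in Set.Ioi (0 : ℝ), G x)).const_mul a⁻¹)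
  have e : -(G t / a) = a⁻¹ * -G t := by ring
  rw [e]
  exact this

theorem deriv_aux (G : ℝ → ℝ) (hG : Continuous G) (hGs : HasCompactSupport G) (a : ℝ)
    (ha : a ≠ 0) (t : ℝ) :
    HasDerivAt (fun u => ∫ r in Set.Ioi (0 : ℝ), G (u + r * a)) (-(G t / a)) t := by
  rcases lt_or_gt_of_ne ha with h | h
  · have h1 := deriv_pos_aux (fun x => G (-x)) (hG.comp continuous_neg)
      (hGs.comp_homeomorph (Homeomorph.neg ℝ)) (-a) (by linarith) (-t)
    have h2 := h1.comp t (hasDerivAt_neg t)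
    have e1 : (fun u => ∫ r in Set.Ioi (0 : ℝ), G (u + r * a)) =
        (fun u => ∫ r in Set.Ioi (0 : ℝ), G (-(u + r * -a))) ∘ Neg.neg := by
      funext u
      simp only [Function.comp]
      congr 1
      funext r
      congr 1
      ring
    have e2 : -(G t / a) = -(G (- -t) / -a) * -1 := by
      rw [neg_neg, div_neg]; ring
    rw [e1, e2]
    exact h2
  · exact deriv_pos_aux G hG hGs a h t

theorem G_aux (g : ℝ × ℝ → ℝ) (hg : Continuous g) (hgs : HasCompactSupport g) :
    Continuous (fun u => ∫ s : ℝ, g (u, s)) ∧ HasCompactSupport (fun u => ∫ s : ℝ, g (u, s)) := by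
  constructor
  · have hK : IsCompact (Prod.snd '' tsupport g) := hgs.isCompact.image continuous_snd
    have hz : ∀ u s, s ∉ Prod.snd '' tsupport g → g (u, s) = 0 := fun u s hs =>
      image_eq_zero_of_notMem_tsupport (fun h' => hs ⟨(u, s), h', rfl⟩)
    have : (fun u => ∫ s : ℝ, g (u, s))
        = fun u => ∫ s in Prod.snd '' tsupport g, g (u, s) := by
      funext u
      exact (setIntegral_eq_integral_of_forall_compl_eq_zero (μ := volume) (fun s hs => hz u s hs)).symm
    rw [this]
    exact continuous_parametric_integral_of_continuous (f := fun u s => g (u, s))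
      (by simpa [Function.uncurry_def] using hg) hK
  · refine HasCompactSupport.intro (K := Prod.fst '' tsupport g)
      (hgs.isCompact.image continuous_fst) ?_
    intro u hu
    have : ∀ s, g (u, s) = 0 := fun s =>
      image_eq_zero_of_notMem_tsupport (fun h' => hu ⟨(u, s), h', rfl⟩)
    simp [this]

theorem int_aux (g : ℝ × ℝ → ℝ) (hg : Continuous g) (hgs : HasCompactSupport g) (a b u : ℝ)
    (ha : a ≠ 0) :
    Integrable (fun s : ℝ => ∫ r in Set.Ioi (0 : ℝ), g (u + r * a, s + r * b)) ∧
    ∫ s : ℝ, ∫ r in Set.Ioi (0 : ℝ), g (u + r * a, s + r * b)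
      = ∫ r in Set.Ioi (0 : ℝ), ∫ s : ℝ, g (u + r * a, s) := by
  have hcs : HasCompactSupport (fun p : ℝ × ℝ => g (u + p.2 * a, p.1 + p.2 * b)) :=
    cs_comp_aux g hgs (fun p => (u + p.2 * a, p.1 + p.2 * b))
      (fun y => (y.2 - (y.1 - u) / a * b, (y.1 - u) / a)) (by fun_prop)
      (by rintro ⟨s, r⟩; ext <;> simp [ha])
  have hc : Continuous (fun p : ℝ × ℝ => g (u + p.2 * a, p.1 + p.2 * b)) := by fun_prop
  have hi : Integrable (fun p : ℝ × ℝ => g (u + p.2 * a, p.1 + p.2 * b)) :=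
    hc.integrable_of_hasCompactSupport hcs
  have hi' : Integrable (fun p : ℝ × ℝ => g (u + p.2 * a, p.1 + p.2 * b))
      ((volume : Measure ℝ).prod (volume.restrict (Set.Ioi (0 : ℝ)))) := by
    refine Integrable.mono_measure hi ?_
    exact Measure.prod_mono le_rfl Measure.restrict_le_self
  refine ⟨hi'.integral_prod_left, ?_⟩
  rw [integral_integral_swap (f := fun s r => g (u + r * a, s + r * b)) hi']
  congr 1
  funext r
  exact integral_add_right_eq_self (fun s => g (u + r * a, s)) (r * b)

theorem star_transform_inversion (f : ℝ × ℝ → ℝ)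
    (hf : Continuous f) (hsupp : HasCompactSupport f)
    (m : ℕ) (γ : Fin m → ℝ × ℝ) (c : Fin m → ℝ)
    (hγunit : ∀ i, (γ i).1 ^ 2 + (γ i).2 ^ 2 = 1)
    (hγdist : Function.Injective γ)
    (hc : ∀ i, c i ≠ 0)
    (ψ : ℝ × ℝ) (hψ : ψ.1 ^ 2 + ψ.2 ^ 2 = 1)
    (hψγ : ∀ i, dot ψ (γ i) ≠ 0)
    (hw : (∑ i, c i / dot ψ (γ i)) ≠ 0) (t : ℝ) :
    ∃ d : ℝ,
      HasDerivAt (fun u => radon (fun x => ∑ i, c i * divBeam (γ i) f x) ψ u) d t ∧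
      radon f ψ t = (-1 / (∑ i, c i / dot ψ (γ i))) * d := by
  set g : ℝ × ℝ → ℝ := fun p => f (p.1 • ψ + p.2 • (-ψ.2, ψ.1)) with hgdef
  have hg : Continuous g := by fun_prop
  have hgs : HasCompactSupport g := by
    refine cs_comp_aux f hsupp (fun p => p.1 • ψ + p.2 • (-ψ.2, ψ.1))
      (fun y => (y.1 * ψ.1 + y.2 * ψ.2, -y.1 * ψ.2 + y.2 * ψ.1)) (by fun_prop) ?_
    rintro ⟨u, s⟩
    ext
    · simp
      linear_combination u * hψ
    · simp
      linear_combination s * hψ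
  have hbeam : ∀ i u s, divBeam (γ i) f (u • ψ + s • (-ψ.2, ψ.1)) =
      ∫ r in Set.Ioi (0 : ℝ), g (u + r * dot ψ (γ i),
        s + r * (-ψ.2 * (γ i).1 + ψ.1 * (γ i).2)) := by
    intro i u s
    unfold divBeam
    congr 1
    funext r
    simp only [hgdef]
    congr 1
    ext
    · simp [dot]
      linear_combination (-r * (γ i).1) * hψ
    · simp [dot]
      linear_combination (-r * (γ i).2) * hψ
  obtain ⟨hGc, hGs⟩ := G_aux g hg hgs
  have hrad : ∀ u, radon (fun x => ∑ i, c i * divBeam (γ i) f x) ψ u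
      = ∑ i, c i * ∫ r in Set.Ioi (0 : ℝ), ∫ s : ℝ, g (u + r * dot ψ (γ i), s) := by
    intro u
    unfold radon
    simp only [hbeam]
    rw [integral_finsetSum]
    · refine Finset.sum_congr rfl fun i _ => ?_
      rw [integral_const_mul, (int_aux g hg hgs _ _ u (hψγ i)).2]
    · intro i _
      exact (int_aux g hg hgs _ _ u (hψγ i)).1.const_mul _
  refine ⟨∑ i, c i * (-((∫ s : ℝ, g (t, s)) / dot ψ (γ i))), ?_, ?_⟩
  · rw [funext hrad]
    exact HasDerivAt.fun_sum fun i _ =>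
      (deriv_aux (fun u => ∫ s : ℝ, g (u, s)) hGc hGs _ (hψγ i) t).const_mul (c i)
  · have h1 : radon f ψ t = ∫ s : ℝ, g (t, s) := rfl
    have h2 : ∑ i, c i * (-((∫ s : ℝ, g (t, s)) / dot ψ (γ i)))
        = -(∑ i, c i / dot ψ (γ i)) * ∫ s : ℝ, g (t, s) := by
      rw [← Finset.sum_neg_distrib, Finset.sum_mul]
      exact Finset.sum_congr rfl fun i _ => by ring
    rw [h1, h2]
    field_simp
end

section
/- Let f : ℝ² → ℝ be continuous with compact support, let γ_1, γ_2 be non-collinear unit vectors in ℝ² (γ_1 ≠ ±γ_2), let c_1, c_2 be nonzero reals, and let V f = c_1 X_{γ_1} f + c_2 X_{γ_2} f be the V-line transform. Let ψ be a unit vector with ⟨ψ,γ_1⟩ ≠ 0, ⟨ψ,γ_2⟩ ≠ 0, and c_2⟨ψ,γ_1⟩ + c_1⟨ψ,γ_2⟩ ≠ 0. Then for every t ∈ ℝ, Rf(ψ, t) = [−⟨ψ,γ_1⟩⟨ψ,γ_2⟩ / (c_2⟨ψ,γ_1⟩ + c_1⟨ψ,γ_2⟩)] · d/dt R(V f)(ψ,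 t). -/
open MeasureTheory Real

lemma radon_lem_cont (f : ℝ × ℝ → ℝ) (hf : Continuous f) (hsupp : HasCompactSupport f)
    (ψ : ℝ × ℝ) (hψ : ψ.1 ^ 2 + ψ.2 ^ 2 = 1) :
    Continuous (radon f ψ) ∧ ∃ K : ℝ, ∀ p, K < |p| → radon f ψ p = 0 := by
  obtain ⟨K, hK⟩ := (hsupp.isCompact.image
    (f := fun x : ℝ × ℝ => (dot x ψ, dot x (-ψ.2, ψ.1)))
    (by unfold dot; fun_prop)).isBounded.exists_norm_le
  have key : ∀ p s : ℝ, f (p • ψ + s • (-ψ.2, ψ.1)) ≠ 0 → |p| ≤ K ∧ |s| ≤ K := by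
    intro p s h
    have h1 := hK _ ⟨_, subset_tsupport f h, rfl⟩
    have e : ((dot (p • ψ + s • (-ψ.2, ψ.1)) ψ, dot (p • ψ + s • (-ψ.2, ψ.1)) (-ψ.2, ψ.1)) : ℝ × ℝ)
        = (p, s) := by
      simp only [dot, Prod.fst_add, Prod.snd_add, Prod.smul_fst, Prod.smul_snd, smul_eq_mul]
      ext
      · simp only; linear_combination p * hψ
      · simp only; linear_combination s * hψ
    simp only at h1
    rw [e] at h1
    simpa [Prod.norm_def] using h1
  constructor
  · have : radon f ψ = fun p => ∫ s in Set.Icc (-K) K, f (p • ψ + s • (-ψ.2, ψ.1)) := by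
      funext p
      unfold radon
      rw [setIntegral_eq_integral_of_forall_compl_eq_zero]
      intro s hs
      by_contra h
      exact hs (abs_le.mp (key p s h).2)
    rw [this]
    apply continuous_parametric_integral_of_continuous _ isCompact_Icc
    fun_prop
  · refine ⟨K, fun p hp => ?_⟩
    unfold radon
    rw [← integral_zero ℝ ℝ]
    congr 1
    funext s
    by_contra h
    exact absurd (key p s h).1 (not_le.mpr hp)

lemma radon_lem_int (f : ℝ × ℝ → ℝ) (hf : Continuous f) (hsupp : HasCompactSupport f)
    (γ ψ : ℝ × ℝ) (hψ : ψ.1 ^ 2 + ψ.2 ^ 2 = 1) (ha : dot ψ γ ≠ 0) (u : ℝ) :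
    Integrable (fun z : ℝ × ℝ => f (u • ψ + z.1 • (-ψ.2, ψ.1) + z.2 • γ))
      ((volume : Measure ℝ).prod (volume.restrict (Set.Ioi (0:ℝ)))) := by
  have hc : Continuous (fun z : ℝ × ℝ => f (u • ψ + z.1 • (-ψ.2, ψ.1) + z.2 • γ)) := by fun_prop
  have hs : HasCompactSupport (fun z : ℝ × ℝ => f (u • ψ + z.1 • (-ψ.2, ψ.1) + z.2 • γ)) := by
    apply HasCompactSupport.intro (hsupp.isCompact.image
      (f := fun x : ℝ × ℝ => (dot x (-ψ.2, ψ.1) - (dot x ψ - u) / dot ψ γ * dot γ (-ψ.2, ψ.1),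
        (dot x ψ - u) / dot ψ γ)) (by unfold dot; fun_prop))
    intro z hz
    by_contra h
    apply hz
    refine ⟨_, subset_tsupport f h, ?_⟩
    have e1 : dot (u • ψ + z.1 • (-ψ.2, ψ.1) + z.2 • γ) ψ - u = z.2 * dot ψ γ := by
      simp only [dot, Prod.fst_add, Prod.snd_add, Prod.smul_fst, Prod.smul_snd, smul_eq_mul]
      linear_combination u * hψ
    have e2 : dot (u • ψ + z.1 • (-ψ.2, ψ.1) + z.2 • γ) (-ψ.2, ψ.1)
        = z.1 + z.2 * dot γ (-ψ.2, ψ.1) := by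
      simp only [dot, Prod.fst_add, Prod.snd_add, Prod.smul_fst, Prod.smul_snd, smul_eq_mul]
      linear_combination z.1 * hψ
    simp only [e1, e2, mul_div_cancel_right₀ _ ha]
    ext <;> simp
  have := hc.integrable_of_hasCompactSupport (μ := (volume : Measure (ℝ × ℝ))) hs
  rw [Measure.volume_eq_prod] at this
  have h2 := this.restrict (s := Set.univ ×ˢ Set.Ioi (0:ℝ))
  rwa [← Measure.prod_restrict, Measure.restrict_univ] at h2

lemma radon_lem_swap (f : ℝ × ℝ → ℝ) (hf : Continuous f) (hsupp : HasCompactSupport f)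
    (γ ψ : ℝ × ℝ) (hψ : ψ.1 ^ 2 + ψ.2 ^ 2 = 1) (ha : dot ψ γ ≠ 0) (u : ℝ) :
    radon (divBeam γ f) ψ u = ∫ r in Set.Ioi (0:ℝ), radon f ψ (u + dot ψ γ * r) := by
  have hi := radon_lem_int f hf hsupp γ ψ hψ ha u
  unfold radon divBeam
  rw [integral_integral_swap hi]
  congr 1
  funext r
  rw [← integral_add_right_eq_self _ (-(r * dot γ (-ψ.2, ψ.1)))]
  congr 1
  funext s
  congr 1
  simp only [dot]
  ext
  · simp only [Prod.fst_add, Prod.snd_add, Prod.smul_fst, Prod.smul_snd, smul_eq_mul]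
    linear_combination (-r * γ.1) * hψ
  · simp only [Prod.fst_add, Prod.snd_add, Prod.smul_fst, Prod.smul_snd, smul_eq_mul]
    linear_combination (-r * γ.2) * hψ

lemma deriv_lem (G : ℝ → ℝ) (hG : Continuous G) (K : ℝ) (hK : ∀ p, K < |p| → G p = 0)
    (a : ℝ) (ha : a ≠ 0) (t : ℝ) :
    HasDerivAt (fun u => ∫ r in Set.Ioi (0:ℝ), G (u + a * r)) (-(G t / a)) t := by
  obtain ⟨M, hM0, hM⟩ : ∃ M : ℝ, 0 < M ∧ |a| * M = |K| + |t| + 1 := by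
    refine ⟨(|K| + |t| + 1) / |a|, by positivity, ?_⟩
    field_simp
  have h1 : HasDerivAt (fun u => a⁻¹ * ∫ x in u..(a * M), G x) (a⁻¹ * (- G t)) t :=
    (intervalIntegral.integral_hasDerivAt_left (hG.intervalIntegrable _ _)
      hG.stronglyMeasurable.stronglyMeasurableAtFilter hG.continuousAt).const_mul _
  have h2 : a⁻¹ * (- G t) = -(G t / a) := by field_simp
  rw [← h2]
  refine h1.congr_of_eventuallyEq ?_
  have hev : ∀ᶠ u in nhds t, |u| < |t| + 1 :=
    continuous_abs.continuousAt.eventually_lt continuousAt_const (by simp)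
  filter_upwards [hev] with u hu
  have hT : 0 ≤ M - u / a := by
    have : |u / a| ≤ M := by
      rw [abs_div, div_le_iff₀ (abs_pos.mpr ha)]
      nlinarith [abs_nonneg K]
    linarith [le_abs_self (u / a)]
  have e1 : ∫ r in Set.Ioi (0:ℝ), G (u + a * r) = ∫ r in Set.Ioc (0:ℝ) (M - u / a), G (u + a * r) := by
    apply setIntegral_eq_of_subset_of_forall_sdiff_eq_zero measurableSet_Ioi
      Set.Ioc_subset_Ioi_self
    rintro r ⟨hr0, hr⟩
    apply hK
    have hr' : M - u / a < r := by
      by_contra h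
      exact hr ⟨hr0, not_lt.mp h⟩
    have e : u + a * r = a * (u / a + r) := by field_simp
    rw [e, abs_mul]
    have h3 : M < |u / a + r| := lt_of_lt_of_le (by linarith) (le_abs_self _)
    have h4 := mul_lt_mul_of_pos_left h3 (abs_pos.mpr ha)
    linarith [le_abs_self K, abs_nonneg t]
  rw [e1, ← intervalIntegral.integral_of_le hT, intervalIntegral.integral_comp_add_mul _ ha]
  have e2 : u + a * (M - u / a) = a * M := by field_simp; ring
  rw [e2]
  simp

theorem vline_transform_inversion (f : ℝ × ℝ → ℝ)
    (hf : Continuous f) (hsupp : HasCompactSupport f)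
    (γ₁ γ₂ : ℝ × ℝ)
    (hγ₁ : γ₁.1 ^ 2 + γ₁.2 ^ 2 = 1) (hγ₂ : γ₂.1 ^ 2 + γ₂.2 ^ 2 = 1)
    (hncol : γ₁ ≠ γ₂ ∧ γ₁ ≠ -γ₂)
    (c₁ c₂ : ℝ) (hc₁ : c₁ ≠ 0) (hc₂ : c₂ ≠ 0)
    (ψ : ℝ × ℝ) (hψ : ψ.1 ^ 2 + ψ.2 ^ 2 = 1)
    (h₁ : dot ψ γ₁ ≠ 0) (h₂ : dot ψ γ₂ ≠ 0)
    (hden : c₂ * dot ψ γ₁ + c₁ * dot ψ γ₂ ≠ 0) (t : ℝ) :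
    ∃ d : ℝ,
      HasDerivAt
        (fun u => radon (fun x => c₁ * divBeam γ₁ f x + c₂ * divBeam γ₂ f x) ψ u) d t ∧
      radon f ψ t =
        (-(dot ψ γ₁ * dot ψ γ₂) / (c₂ * dot ψ γ₁ + c₁ * dot ψ γ₂)) * d := by
  obtain ⟨hG, K, hK⟩ := radon_lem_cont f hf hsupp ψ hψ
  have hd₁ := (deriv_lem _ hG K hK _ h₁ t).const_mul c₁
  have hd₂ := (deriv_lem _ hG K hK _ h₂ t).const_mul c₂
  refine ⟨_, (hd₁.add hd₂).congr_of_eventuallyEq (Filter.Eventually.of_forall fun u => ?_), ?_⟩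
  · simp only [Pi.add_apply]
    rw [← radon_lem_swap f hf hsupp γ₁ ψ hψ h₁ u, ← radon_lem_swap f hf hsupp γ₂ ψ hψ h₂ u]
    have i₁ := (radon_lem_int f hf hsupp γ₁ ψ hψ h₁ u).integral_prod_left.const_mul c₁
    have i₂ := (radon_lem_int f hf hsupp γ₂ ψ hψ h₂ u).integral_prod_left.const_mul c₂
    unfold radon divBeam
    rw [← integral_const_mul, ← integral_const_mul]
    exact integral_add i₁ i₂
  · have e : c₁ * -(radon f ψ t / dot ψ γ₁) + c₂ * -(radon f ψ t / dot ψ γ₂)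
        = -(c₂ * dot ψ γ₁ + c₁ * dot ψ γ₂) * radon f ψ t / (dot ψ γ₁ * dot ψ γ₂) := by
      field_simp
      ring
    rw [e]
    generalize c₂ * dot ψ γ₁ + c₁ * dot ψ γ₂ = D at hden
    field_simp
end

section
/- Let f : ℝ² → ℝ be continuous with compact support and let γ, ψ be unit vectors in ℝ² with ⟨ψ,γ⟩ ≠ 0. Then for every t ∈ ℝ, Rf(ψ, t) = −⟨ψ,γ⟩ · d/dt R(X_γ f)(ψ, t). In particular, the divergent beam transform X_γ can be inverted by applying this formula and then inverting the Radon transform. -/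
open MeasureTheory Real

theorem divBeam_aux (h : ℝ → ℝ → ℝ) (hc : Continuous (Function.uncurry h)) (M : ℝ)
    (hM1 : ∀ p q, M < |p| → h p q = 0) (hM2 : ∀ p q, M < |q| → h p q = 0)
    (a b : ℝ) (ha : a ≠ 0) (t : ℝ) :
    HasDerivAt (fun u => ∫ s : ℝ, ∫ τ in Set.Ioi (0 : ℝ), h (u + τ * a) (s + τ * b))
      (-(a⁻¹ * ∫ s : ℝ, h t s)) t := by
  have ha' : 0 < |a| := abs_pos.mpr ha
  set H : ℝ → ℝ := fun p => ∫ s : ℝ, h p s with hH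
  have hHc : Continuous H := by
    have : H = fun p => ∫ s in Set.Icc (-M) M, h p s := by
      funext p
      refine (setIntegral_eq_integral_of_forall_compl_eq_zero ?_).symm
      intro q hq
      refine hM2 p q ?_
      by_contra hcon
      exact hq (abs_le.mp (not_lt.mp hcon))
    rw [this]
    exact continuous_parametric_integral_of_continuous hc isCompact_Icc
  have hH0 : ∀ p, M < |p| → H p = 0 := by
    intro p hp
    simp [hH, hM1 p _ hp]
  have hfar : ∀ u τ : ℝ, (M + |u|) / |a| < |τ| → M < |u + τ * a| := by
    intro u τ hτ
    rw [div_lt_iff₀ ha', ← abs_mul] at hτ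
    have := abs_sub_abs_le_abs_sub (τ * a) (-u)
    rw [abs_neg, sub_neg_eq_add, add_comm (τ * a)] at this
    linarith
  have fub : ∀ u, (∫ s : ℝ, ∫ τ in Set.Ioi (0 : ℝ), h (u + τ * a) (s + τ * b))
      = ∫ τ in Set.Ioi (0 : ℝ), H (u + a * τ) := by
    intro u
    have hint : Integrable (Function.uncurry fun s τ : ℝ => h (u + τ * a) (s + τ * b))
        ((volume : Measure ℝ).prod volume) := by
      refine Continuous.integrable_of_hasCompactSupport ?_ ?_
      · exact hc.comp (f := fun x : ℝ × ℝ => (u + x.2 * a, x.1 + x.2 * b)) (by fun_prop)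
      · set T := (M + |u|) / |a|
        set S := M + T * |b|
        refine HasCompactSupport.intro
          (isCompact_Icc (a := -S) (b := S) |>.prod (isCompact_Icc (a := -T) (b := T))) ?_
        rintro ⟨s, τ⟩ hx
        simp only [Function.uncurry]
        by_cases hτ : T < |τ|
        · exact hM1 _ _ (hfar u τ hτ)
        · apply hM2
          by_contra hcon
          push Not at hτ hcon
          apply hx
          refine ⟨abs_le.mp ?_, abs_le.mp hτ⟩
          have h1 := abs_sub_abs_le_abs_sub s (-(τ * b))
          rw [abs_neg, sub_neg_eq_add, abs_mul] at h1
          have h2 := mul_le_mul_of_nonneg_right hτ (abs_nonneg b)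
          show |s| ≤ M + T * |b|
          linarith
    have hint' : Integrable (Function.uncurry fun s τ : ℝ => h (u + τ * a) (s + τ * b))
        ((volume : Measure ℝ).prod (volume.restrict (Set.Ioi (0:ℝ)))) := by
      refine hint.mono_measure ?_
      exact Measure.prod_mono le_rfl Measure.restrict_le_self
    rw [integral_integral_swap hint']
    refine integral_congr_ae (Filter.Eventually.of_forall fun τ => ?_)
    simp only [hH]
    rw [integral_add_right_eq_self (fun s => h (u + τ * a) s) (τ * b), mul_comm τ a]
  simp only [fub]
  set T := (|M| + |t| + 2) / |a| with hT
  have hTpos : 0 < T := by positivity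
  have key : ∀ u, |u| < |t| + 1 → (∫ τ in Set.Ioi (0 : ℝ), H (u + a * τ))
      = a⁻¹ * ((∫ x in (0:ℝ)..(u + a * T), H x) - ∫ x in (0:ℝ)..u, H x) := by
    intro u hu
    have e1 : (∫ τ in Set.Ioi (0 : ℝ), H (u + a * τ)) = ∫ τ in (0:ℝ)..T, H (u + a * τ) := by
      rw [intervalIntegral.integral_of_le hTpos.le]
      refine (setIntegral_eq_of_subset_of_forall_sdiff_eq_zero measurableSet_Ioi
        (fun x hx => hx.1) ?_)
      rintro τ ⟨h0, h1⟩
      have h0' : (0:ℝ) < τ := h0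
      have h2 : T < τ := by
        by_contra hcon
        exact h1 ⟨h0, not_lt.mp hcon⟩
      apply hH0
      rw [mul_comm]
      apply hfar
      rw [abs_of_pos h0']
      refine lt_of_le_of_lt ?_ h2
      rw [hT]
      rw [div_le_div_iff_of_pos_right ha']
      linarith [le_abs_self M]
    rw [e1, intervalIntegral.integral_comp_add_mul H ha u,
      intervalIntegral.integral_interval_sub_left (hHc.intervalIntegrable _ _)
        (hHc.intervalIntegrable _ _)]
    simp
  have hprim : ∀ x, HasDerivAt (fun y => ∫ x in (0:ℝ)..y, H x) (H x) x := fun x =>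
    intervalIntegral.integral_hasDerivAt_right (hHc.intervalIntegrable _ _)
      (hHc.stronglyMeasurableAtFilter _ _) hHc.continuousAt
  have hz : H (t + a * T) = 0 := by
    apply hH0
    rw [mul_comm]
    apply hfar
    rw [abs_of_pos hTpos, hT]
    rw [div_lt_div_iff_of_pos_right ha']
    linarith [le_abs_self M]
  have hd : HasDerivAt (fun u => a⁻¹ * ((∫ x in (0:ℝ)..(u + a * T), H x) - ∫ x in (0:ℝ)..u, H x))
      (a⁻¹ * (H (t + a * T) - H t)) t :=
    (((hprim (t + a * T)).comp_add_const t (a * T)).sub (hprim t)).const_mul a⁻¹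
  rw [hz] at hd
  have hd' : HasDerivAt (fun u => ∫ τ in Set.Ioi (0 : ℝ), H (u + a * τ))
      (a⁻¹ * (0 - H t)) t := by
    refine hd.congr_of_eventuallyEq ?_
    have : ∀ᶠ u in nhds t, |u| < |t| + 1 :=
      (continuous_abs.continuousAt (x := t)).eventually_lt continuousAt_const (by linarith)
    filter_upwards [this] with u hu using key u hu
  convert hd' using 1
  ring

theorem divBeam_inversion (f : ℝ × ℝ → ℝ)
    (hf : Continuous f) (hsupp : HasCompactSupport f)
    (γ : ℝ × ℝ) (hγ : γ.1 ^ 2 + γ.2 ^ 2 = 1)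
    (ψ : ℝ × ℝ) (hψ : ψ.1 ^ 2 + ψ.2 ^ 2 = 1)
    (hne : dot ψ γ ≠ 0) (t : ℝ) :
    ∃ d : ℝ,
      HasDerivAt (fun u => radon (divBeam γ f) ψ u) d t ∧
      radon f ψ t = -dot ψ γ * d := by
  obtain ⟨C, hC⟩ := hsupp.isCompact.isBounded.exists_norm_le
  have hC0 : ∀ x, C < ‖x‖ → f x = 0 := by
    intro x hx
    by_contra hcon
    exact absurd (hC x (subset_tsupport f hcon)) (not_le.mpr hx)
  have h1 : |ψ.1| ≤ 1 := by rw [abs_le_one_iff_mul_self_le_one]; nlinarith [sq_nonneg ψ.2]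
  have h2 : |ψ.2| ≤ 1 := by rw [abs_le_one_iff_mul_self_le_one]; nlinarith [sq_nonneg ψ.1]
  have bd : ∀ x y c d : ℝ, |c| ≤ 1 → |d| ≤ 1 → |c * x + d * y| ≤ 2 * ‖(x, y)‖ := by
    intro x y c d hc hd
    have hx : |x| ≤ ‖(x, y)‖ := norm_fst_le (x, y)
    have hy : |y| ≤ ‖(x, y)‖ := norm_snd_le (x, y)
    have := abs_add_le (c * x) (d * y)
    rw [abs_mul, abs_mul] at this
    nlinarith [abs_nonneg x, abs_nonneg y]
  have hh := divBeam_aux (fun p q => f (p • ψ + q • (-ψ.2, ψ.1)))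
    (hf.comp (f := fun x : ℝ × ℝ => x.1 • ψ + x.2 • (-ψ.2, ψ.1)) (by fun_prop)) (2 * C) (by
      intro p q hp
      apply hC0
      have := bd (p * ψ.1 + q * -ψ.2) (p * ψ.2 + q * ψ.1) ψ.1 ψ.2 h1 h2
      rw [show ψ.1 * (p * ψ.1 + q * -ψ.2) + ψ.2 * (p * ψ.2 + q * ψ.1) = p by
        linear_combination p * hψ] at this
      have h3 : C < ‖(p * ψ.1 + q * -ψ.2, p * ψ.2 + q * ψ.1)‖ := by linarith
      exact h3) (by
      intro p q hp
      apply hC0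
      have := bd (p * ψ.1 + q * -ψ.2) (p * ψ.2 + q * ψ.1) (-ψ.2) ψ.1 (by rwa [abs_neg]) h1
      rw [show -ψ.2 * (p * ψ.1 + q * -ψ.2) + ψ.1 * (p * ψ.2 + q * ψ.1) = q by
        linear_combination q * hψ] at this
      have h3 : C < ‖(p * ψ.1 + q * -ψ.2, p * ψ.2 + q * ψ.1)‖ := by linarith
      exact h3)
    (dot ψ γ) (-ψ.2 * γ.1 + ψ.1 * γ.2) hne t
  refine ⟨-((dot ψ γ)⁻¹ * radon f ψ t), ?_, ?_⟩
  rotate_left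
  · show radon f ψ t = -dot ψ γ * (-((dot ψ γ)⁻¹ * radon f ψ t))
    field_simp
  · refine hh.congr_of_eventuallyEq (Filter.Eventually.of_forall fun u => ?_)
    simp only [radon, divBeam]
    congr 1
    funext s
    congr 1
    funext τ
    congr 1
    ext
    · simp [dot]
      linear_combination (-τ * γ.1) * hψ
    · simp [dot]
      linear_combination (-τ * γ.2) * hψ
end

section
/- Let γ_1, …, γ_m be distinct unit vectors in ℝ² and c_1, …, c_m nonzero reals, and let S f = ∑_{i=1}^m c_i X_{γ_i} f be the star transform acting on continuous compactly supported functions f : ℝ² → ℝ. Then S is injective (i.e., Sf = 0 implies f = 0 for continuous compactly supported f) if and only if the star transform is not symmetric. -/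
open MeasureTheory Real

/-- The star transform is symmetric if the index set can be partitioned into pairs
`{i, j}` with `γ i = -γ j` and `c i = c j`, i.e. there is a fixed-point-free involution
`σ` of the indices with `γ (σ i) = -γ i` and `c (σ i) = c i`. -/
def IsSymmetricStar (m : ℕ) (γ : Fin m → ℝ × ℝ) (c : Fin m → ℝ) : Prop :=
  ∃ σ : Equiv.Perm (Fin m),
    (∀ i, σ i ≠ i) ∧ (∀ i, σ (σ i) = i) ∧
    (∀ i, γ (σ i) = -γ i) ∧ (∀ i, c (σ i) = c i)


lemma st_shift (E : ℂ → ℂ) (hE : ∀ x y, E (x + y) = E x * E y) (u : ℂ → ℂ) (b : ℂ) :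
    ∫ x, E x * u (x + b) = E (-b) * ∫ x, E x * u x := by
  have h := integral_add_right_eq_self (μ := (volume : Measure ℂ)) (fun x => E (x - b) * u x) b
  simp only [add_sub_cancel_right] at h
  rw [h, ← integral_const_mul]
  congr 1; ext x
  rw [sub_eq_add_neg, hE]; ring

lemma st_int (E : ℂ → ℂ) (hEc : Continuous E) (hE1 : ∀ x, ‖E x‖ = 1) (u : ℂ → ℂ)
    (hu : Integrable u) : Integrable (fun x => E x * u x) := by
  refine hu.bdd_mul (c := 1) hEc.aestronglyMeasurable ?_
  exact Filter.Eventually.of_forall fun x => (hE1 x).le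

lemma st_diff (E : ℂ → ℂ) (hE : ∀ x y, E (x + y) = E x * E y) (hEc : Continuous E)
    (hE1 : ∀ x, ‖E x‖ = 1) (u : ℂ → ℂ) (hu : Integrable u) (b : ℂ) (hb : E (-b) = -1) :
    ∫ x, E x * (u x - u (x + b)) = 2 * ∫ x, E x * u x := by
  have h1 := st_int E hEc hE1 u hu
  have h2 := st_int E hEc hE1 _ (hu.comp_add_right b)
  simp only [mul_sub]
  rw [integral_sub h1 h2, st_shift E hE u b, hb]
  ring

lemma st_ind {ι : Type*} [DecidableEq ι] (E : ℂ → ℂ) (hE : ∀ x y, E (x + y) = E x * E y)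
    (hEc : Continuous E) (hE1 : ∀ x, ‖E x‖ = 1) (b : ι → ℂ) (S : Finset ι) :
    ∀ (G : ι → ℂ → ℂ) (u : ℂ → ℂ), Integrable u → (∀ i ∈ S, E (-(b i)) = -1) →
      (∀ i ∈ S, Integrable (fun x => G i x - G i (x + b i))) →
      (∀ x, u x + ∑ i ∈ S, G i x = 0) →
      2 * (∫ x, E x * u x) + ∑ i ∈ S, ∫ x, E x * (G i x - G i (x + b i)) = 0 := by
  induction S using Finset.induction_on with
  | empty =>
    intro G u hu _ _ h
    have : u = 0 := by ext x; simpa using h x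
    simp [this]
  | insert k S hk ih =>
    intro G u hu hb hG h
    have hbk := hb k (Finset.mem_insert_self k S)
    have hGk := hG k (Finset.mem_insert_self k S)
    have hu' : Integrable (fun x => u x - u (x + b k)) := hu.sub (hu.comp_add_right (b k))
    have key := ih (fun i x => G i x - G i (x + b k))
      (fun x => (u x - u (x + b k)) + (G k x - G k (x + b k))) (hu'.add hGk)
      (fun i hi => hb i (Finset.mem_insert_of_mem hi))
      (by
        intro i hi
        have h1 := hG i (Finset.mem_insert_of_mem hi)
        have h2 := h1.sub (h1.comp_add_right (b k))
        refine h2.congr (Filter.Eventually.of_forall fun x => ?_)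
        simp only [Pi.sub_apply]
        rw [add_right_comm x (b k) (b i)]
        ring)
      (by
        intro x
        have h1 := h x
        have h2 := h (x + b k)
        rw [Finset.sum_insert hk] at h1 h2
        rw [Finset.sum_sub_distrib]
        linear_combination h1 - h2)
    have e1 : ∫ x, E x * ((u x - u (x + b k)) + (G k x - G k (x + b k)))
        = 2 * (∫ x, E x * u x) + ∫ x, E x * (G k x - G k (x + b k)) := by
      rw [← st_diff E hE hEc hE1 u hu (b k) hbk]
      rw [← integral_add (st_int E hEc hE1 _ hu') (st_int E hEc hE1 _ hGk)]
      simp only [mul_add]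
    have e2 : ∀ i ∈ S, ∫ x, E x * ((G i x - G i (x + b k)) - (G i (x + b i) - G i (x + b i + b k)))
        = 2 * ∫ x, E x * (G i x - G i (x + b i)) := by
      intro i hi
      rw [← st_diff E hE hEc hE1 _ (hG i (Finset.mem_insert_of_mem hi)) (b k) hbk]
      congr 1; ext x
      rw [add_right_comm x (b k) (b i)]
      ring
    rw [e1, Finset.sum_congr rfl e2, ← Finset.mul_sum] at key
    rw [Finset.sum_insert hk]
    linear_combination key / 2

/-- transform of the truncated beam -/
lemma st_beam (E : ℂ → ℂ) (hE : ∀ x y, E (x + y) = E x * E y) (hEc : Continuous E)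
    (hE1 : ∀ x, ‖E x‖ = 1) (g : ℂ → ℂ) (hg : Continuous g) (hgs : HasCompactSupport g)
    (v : ℂ) (s : ℝ) (hs : 0 ≤ s) :
    Integrable (fun x => ∫ t in (0 : ℝ)..s, g (x + t • v)) ∧
    ∫ x, E x * ∫ t in (0 : ℝ)..s, g (x + t • v) =
      (∫ t in (0 : ℝ)..s, E (-(t • v))) * ∫ x, E x * g x := by
  have hgi : Integrable g := hg.integrable_of_hasCompactSupport hgs
  have hp : Integrable (fun p : ℂ × ℝ => g (p.1 + p.2 • v))
      ((volume : Measure ℂ).prod ((volume : Measure ℝ).restrict (Set.Ioc 0 s))) := by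
    have hc : Continuous (fun p : ℂ × ℝ => g (p.1 + p.2 • v)) := by fun_prop
    rw [integrable_prod_iff' hc.aestronglyMeasurable]
    refine ⟨Filter.Eventually.of_forall fun t => hgi.comp_add_right (t • v), ?_⟩
    have : ∀ t : ℝ, ∫ x, ‖g (x + t • v)‖ = ∫ x, ‖g x‖ := fun t =>
      integral_add_right_eq_self (fun x => ‖g x‖) (t • v)
    simp only [this]
    exact integrable_const _
  have hp2 : Integrable (fun p : ℂ × ℝ => E p.1 * g (p.1 + p.2 • v))
      ((volume : Measure ℂ).prod ((volume : Measure ℝ).restrict (Set.Ioc 0 s))) := by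
    refine hp.bdd_mul (c := 1) (by fun_prop) ?_
    exact Filter.Eventually.of_forall fun x => (hE1 _).le
  simp only [intervalIntegral.integral_of_le hs]
  refine ⟨hp.integral_prod_left, ?_⟩
  have e0 : ∀ x, E x * (∫ t in Set.Ioc 0 s, g (x + t • v)) =
      ∫ t in Set.Ioc 0 s, E x * g (x + t • v) := fun x => (integral_const_mul _ _).symm
  simp only [e0]
  rw [integral_integral_swap hp2, ← integral_mul_const]
  congr 1; ext t
  rw [st_shift E hE]

/-- main Fourier identity -/
lemma st_main (m : ℕ) (γ : Fin m → ℂ) (c : Fin m → ℝ) (g : ℂ → ℂ) (hg : Continuous g)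
    (hgs : HasCompactSupport g)
    (h : ∀ x, ∑ i, (c i : ℂ) * ∫ t in Set.Ioi (0 : ℝ), g (x + t • γ i) = 0) (w : ℂ)
    (ha : ∀ i, inner ℝ (γ i) w ≠ 0) (hγ : ∀ i, γ i ≠ 0)
    (hw : ∑ i, c i / inner ℝ (γ i) w ≠ 0) :
    FourierTransform.fourier g w = 0 := by
  set E : ℂ → ℂ := fun v => Complex.exp (((-2 * π * inner ℝ v w : ℝ) : ℂ) * Complex.I) with hEdef
  have hE : ∀ x y, E (x + y) = E x * E y := by
    intro x y
    simp only [hEdef, inner_add_left, ← Complex.exp_add]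
    congr 1; push_cast; ring
  have hEc : Continuous E := by simp only [hEdef]; fun_prop
  have hE1 : ∀ x, ‖E x‖ = 1 := fun x => Complex.norm_exp_ofReal_mul_I _
  have hF : FourierTransform.fourier g w = ∫ x, E x * g x := by
    rw [Real.fourier_eq']
    simp [hEdef]
  set s : Fin m → ℝ := fun i => 1 / (2 * |inner ℝ (γ i) w|) with hs
  have hspos : ∀ i, 0 < s i := fun i => by
    have := abs_pos.2 (ha i)
    simp only [hs]; positivity
  have hEs : ∀ i, E (-(s i • γ i)) = -1 := by
    intro i
    simp only [hEdef, hs, inner_neg_left, real_inner_smul_left]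
    rcases lt_or_gt_of_ne (ha i) with h1 | h1
    · rw [abs_of_neg h1]
      have : ((-2 * π * -(1 / (2 * -inner ℝ (γ i) w) * inner ℝ (γ i) w) : ℝ)) = -π := by
        have := ha i
        field_simp
      rw [this]; push_cast
      rw [neg_mul, Complex.exp_neg, Complex.exp_pi_mul_I]; norm_num
    · rw [abs_of_pos h1]
      have : ((-2 * π * -(1 / (2 * inner ℝ (γ i) w) * inner ℝ (γ i) w) : ℝ)) = π := by
        have := ha i
        field_simp
      rw [this, Complex.exp_pi_mul_I]
  have hray : ∀ i x, IntegrableOn (fun t : ℝ => g (x + t • γ i)) (Set.Ioi 0) := by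
    intro i x
    have h1 : HasCompactSupport (fun t : ℝ => g (x + t • γ i)) := by
      refine hgs.comp_isClosedEmbedding ?_
      exact (Homeomorph.addLeft x).isClosedEmbedding.comp
        (isClosedEmbedding_smul_left (hγ i))
    exact ((by fun_prop : Continuous (fun t : ℝ => g (x + t • γ i))).integrable_of_hasCompactSupport
      h1).integrableOn
  have hT : ∀ i x, (∫ t in Set.Ioi (0 : ℝ), g (x + t • γ i)) -
      (∫ t in Set.Ioi (0 : ℝ), g (x + s i • γ i + t • γ i)) =
      ∫ t in (0 : ℝ)..s i, g (x + t • γ i) := by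
    intro i x
    have h1 : (∫ t in Set.Ioi (0 : ℝ), g (x + s i • γ i + t • γ i)) =
        ∫ t in Set.Ioi (s i), g (x + t • γ i) := by
      have := (measurePreserving_add_right volume (s i)).setIntegral_preimage_emb
        (measurableEmbedding_addRight (s i)) (fun t : ℝ => g (x + t • γ i)) (Set.Ioi (s i))
      rw [Set.preimage_add_const_Ioi, sub_self] at this
      rw [← this]
      congr 1; ext t
      congr 1; rw [add_smul]; abel
    rw [h1]
    exact (intervalIntegral.integral_Ioi_sub_Ioi (hray i x) (hspos i).le)
  have hbeam := fun i => st_beam E hE hEc hE1 g hg hgs (γ i) (s i) (hspos i).le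
  have hTc : ∀ i x, (c i : ℂ) * (∫ t in Set.Ioi (0 : ℝ), g (x + t • γ i)) -
      (c i : ℂ) * (∫ t in Set.Ioi (0 : ℝ), g (x + s i • γ i + t • γ i)) =
      (c i : ℂ) * ∫ t in (0 : ℝ)..s i, g (x + t • γ i) := by
    intro i x
    rw [← mul_sub, hT]
  have key := st_ind E hE hEc hE1 (fun i => s i • γ i) Finset.univ
    (fun i x => (c i : ℂ) * ∫ t in Set.Ioi (0 : ℝ), g (x + t • γ i)) 0 (integrable_zero _ _ _)
    (fun i _ => hEs i)
    (by
      intro i _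
      simp only [hTc]
      exact (hbeam i).1.const_mul _)
    (by intro x; simpa using h x)
  simp only [hTc, Pi.zero_apply, mul_zero, integral_zero, zero_add] at key
  have hterm : ∀ i, ∫ x, E x * ((c i : ℂ) * ∫ t in (0 : ℝ)..s i, g (x + t • γ i)) =
      ((c i / inner ℝ (γ i) w : ℝ) : ℂ) * ((-1 / (π * Complex.I)) * ∫ x, E x * g x) := by
    intro i
    have hai : ((inner ℝ (γ i) w : ℝ) : ℂ) ≠ 0 := by exact_mod_cast ha i
    have hpi : (π : ℂ) ≠ 0 := by exact_mod_cast pi_ne_zero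
    have hne : (2 * π * inner ℝ (γ i) w : ℝ) * Complex.I ≠ 0 := by
      refine mul_ne_zero ?_ Complex.I_ne_zero
      push_cast
      exact mul_ne_zero (mul_ne_zero two_ne_zero hpi) hai
    have h0 : ∫ t in (0 : ℝ)..s i, E (-(t • γ i)) =
        -2 / ((2 * π * inner ℝ (γ i) w : ℝ) * Complex.I) := by
      have h2 := hEs i
      have h3 : ∀ t : ℝ, E (-(t • γ i)) =
          Complex.exp ((2 * π * inner ℝ (γ i) w : ℝ) * Complex.I * t) := by
        intro t
        simp only [hEdef, inner_neg_left, real_inner_smul_left]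
        congr 1; push_cast; ring
      rw [h3] at h2
      simp only [h3]
      rw [integral_exp_mul_complex hne, h2]
      norm_num
    have h1 := (hbeam i).2
    calc _ = (c i : ℂ) * ∫ x, E x * ∫ t in (0 : ℝ)..s i, g (x + t • γ i) := by
          rw [← integral_const_mul]; congr 1; ext x; ring
      _ = _ := by
          rw [h1, h0]; push_cast
          field_simp
  simp only [hterm] at key
  rw [← Finset.sum_mul, ← Complex.ofReal_sum] at key
  rw [hF]
  have hpi : (π : ℂ) ≠ 0 := by exact_mod_cast pi_ne_zero
  rcases mul_eq_zero.1 key with h1 | h1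
  · exact absurd (by exact_mod_cast h1) hw
  · rcases mul_eq_zero.1 h1 with h2 | h2
    · simp [hpi] at h2
    · exact h2

/-- If there is one good frequency then `g = 0`. -/
lemma st_inj (m : ℕ) (γ : Fin m → ℂ) (c : Fin m → ℝ) (g : ℂ → ℂ) (hg : Continuous g)
    (hgs : HasCompactSupport g)
    (h : ∀ x, ∑ i, (c i : ℂ) * ∫ t in Set.Ioi (0 : ℝ), g (x + t • γ i) = 0) (w : ℂ)
    (ha : ∀ i, inner ℝ (γ i) w ≠ 0)
    (hw : ∑ i, c i / inner ℝ (γ i) w ≠ 0) : g = 0 := by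
  have hγ : ∀ i, γ i ≠ 0 := by
    intro i hi; apply ha i; simp [hi]
  have hgi : Integrable g := hg.integrable_of_hasCompactSupport hgs
  set Q : ℂ → ℝ := fun w => (∏ i, inner ℝ (γ i) w) *
    ∑ i, c i * ∏ j ∈ Finset.univ.erase i, inner ℝ (γ j) w with hQ
  have hP : ∀ w, (∀ i, inner ℝ (γ i) w ≠ 0) →
      ∑ i, c i * ∏ j ∈ Finset.univ.erase i, inner ℝ (γ j) w =
      (∏ i, inner ℝ (γ i) w) * ∑ i, c i / inner ℝ (γ i) w := by
    intro w hw
    rw [Finset.mul_sum]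
    refine Finset.sum_congr rfl fun i _ => ?_
    rw [← Finset.mul_prod_erase _ _ (Finset.mem_univ i)]
    have := hw i
    field_simp
  have hQw : Q w ≠ 0 := by
    have hp : (∏ i, inner ℝ (γ i) w) ≠ 0 := Finset.prod_ne_zero_iff.2 fun i _ => ha i
    simp only [hQ]; rw [hP w ha]
    exact mul_ne_zero hp (mul_ne_zero hp hw)
  have hlin : ∀ i, AnalyticOnNhd ℝ (fun w : ℂ => inner ℝ (γ i) w) Set.univ := fun i =>
    (innerSL ℝ (γ i)).analyticOnNhd _
  have hQa : AnalyticOnNhd ℝ Q Set.univ := by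
    refine AnalyticOnNhd.mul (Finset.analyticOnNhd_fun_prod _ fun i _ => hlin i) ?_
    refine Finset.analyticOnNhd_fun_sum _ fun i _ => ?_
    exact analyticOnNhd_const.mul (Finset.analyticOnNhd_fun_prod _ fun i _ => hlin i)
  have hFQ : ∀ v, Q v ≠ 0 → FourierTransform.fourier g v = 0 := by
    intro v hv
    have hv1 := left_ne_zero_of_mul hv
    have hv2 := right_ne_zero_of_mul hv
    have hav : ∀ i, inner ℝ (γ i) v ≠ 0 := fun i =>
      Finset.prod_ne_zero_iff.1 hv1 i (Finset.mem_univ i)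
    rw [hP v hav] at hv2
    exact st_main m γ c g hg hgs h v hav hγ (right_ne_zero_of_mul hv2)
  have hFc : Continuous (FourierTransform.fourier g) := by
    exact VectorFourier.fourierIntegral_continuous Real.continuous_fourierChar
      (by exact continuous_inner) hgi
  have hF0 : FourierTransform.fourier g = 0 := by
    ext v
    by_contra hne
    have hnb : ∀ᶠ z in nhds v, FourierTransform.fourier g z ≠ 0 :=
      hFc.continuousAt.eventually_ne hne
    have hQ0 : Q =ᶠ[nhds v] 0 := by
      filter_upwards [hnb] with z hz
      by_contra h0
      exact hz (hFQ z h0)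
    exact hQw (hQa.eqOn_zero_of_preconnected_of_eventuallyEq_zero isPreconnected_univ
      (Set.mem_univ v) hQ0 (Set.mem_univ w))
  have := hg.fourierInv_fourier_eq hgi (by rw [hF0]; exact integrable_zero _ _ _)
  rw [← this, hF0]
  ext v
  rw [Real.fourierInv_eq]
  simp

/-- the algebraic part -/
lemma st_alg (m : ℕ) (γ : Fin m → ℝ × ℝ) (c : Fin m → ℝ)
    (hγunit : ∀ i, (γ i).1 ^ 2 + (γ i).2 ^ 2 = 1)
    (hγdist : Function.Injective γ) (hc : ∀ i, c i ≠ 0)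
    (h : ∀ w : ℝ × ℝ, (∀ i, dot (γ i) w ≠ 0) → ∑ i, c i / dot (γ i) w = 0) (k : Fin m) :
    ∃ j, γ j = -γ k ∧ c j = c k := by
  set p : ℝ × ℝ := (-(γ k).2, (γ k).1) with hp
  have hw : ∀ i (ε : ℝ), dot (γ i) (p + ε • γ k) = dot (γ i) p + ε * dot (γ i) (γ k) := by
    intro i ε; simp [dot]; ring
  have hdich : ∀ i, dot (γ i) p = 0 → γ i = γ k ∨ γ i = -γ k := by
    intro i hi
    have h1 := hγunit i
    have h2 := hγunit k
    simp only [dot, hp] at hi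
    have e1 : (γ i).1 = dot (γ i) (γ k) * (γ k).1 := by
      simp only [dot]; linear_combination (-(γ i).1) * h2 - (γ k).2 * hi
    have e2 : (γ i).2 = dot (γ i) (γ k) * (γ k).2 := by
      simp only [dot]; linear_combination (-(γ i).2) * h2 + (γ k).1 * hi
    have e3 : dot (γ i) (γ k) ^ 2 = 1 := by
      rw [e1, e2] at h1; linear_combination h1 - dot (γ i) (γ k) ^ 2 * h2
    rcases (by simpa using e3 : dot (γ i) (γ k) = 1 ∨ dot (γ i) (γ k) = -1) with h | h
    · left; ext <;> simp [e1, e2, h]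
    · right; ext <;> simp [e1, e2, h]
  have hkk : dot (γ k) (γ k) = 1 := by
    have := hγunit k
    simp only [dot]; linarith
  have hkp : dot (γ k) p = 0 := by simp only [dot, hp]; ring
  have hne : γ k ≠ -γ k := by
    intro hh
    have h0 := self_eq_neg.1 hh
    rw [h0] at hkk
    simp [dot] at hkk
  have hnegdot : ∀ (v u : ℝ × ℝ), dot (-v) u = -dot v u := by
    intro v u; simp [dot]; ring
  let L : Fin m → ℝ := fun i => if γ i = γ k then c i else if γ i = -γ k then -c i else 0
  have hcont : ∀ i, ContinuousAt (fun ε : ℝ => dot (γ i) p + ε * dot (γ i) (γ k)) 0 := by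
    intro i; fun_prop
  have hnz : ∀ i, ∀ᶠ ε in nhdsWithin (0 : ℝ) {0}ᶜ, dot (γ i) p + ε * dot (γ i) (γ k) ≠ 0 := by
    intro i
    by_cases hi : dot (γ i) p = 0
    · filter_upwards [self_mem_nhdsWithin] with ε hε
      have hε' : ε ≠ 0 := hε
      rcases hdich i hi with h1 | h1
      · simp [h1, hkk, hkp, hε']
      · simp [h1, hnegdot, hkk, hkp, hε']
    · exact ((hcont i).eventually_ne (by simpa using hi)).filter_mono nhdsWithin_le_nhds
  have hlim : ∀ i, Filter.Tendsto
      (fun ε : ℝ => ε * (c i / (dot (γ i) p + ε * dot (γ i) (γ k))))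
      (nhdsWithin (0 : ℝ) {0}ᶜ) (nhds (L i)) := by
    intro i
    by_cases hi : dot (γ i) p = 0
    · refine tendsto_const_nhds.congr' ?_
      filter_upwards [self_mem_nhdsWithin] with ε hε
      have hε' : ε ≠ 0 := hε
      rcases hdich i hi with h1 | h1
      · simp only [L, h1, hkk, hkp, if_true]
        simp only [neg_zero, zero_add, mul_one, mul_neg, div_neg]
        field_simp
      · simp only [L, h1, hnegdot, hkk, hkp, if_true, if_neg hne.symm]
        simp only [neg_zero, zero_add, mul_one, mul_neg, div_neg]
        field_simp
    · have hL : L i = 0 := by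
        have h1 : γ i ≠ γ k := fun h1 => hi (by rw [h1, hkp])
        have h2 : γ i ≠ -γ k := fun h2 => hi (by rw [h2, hnegdot, hkp, neg_zero])
        simp [L, h1, h2]
      have h3 : ContinuousAt (fun ε : ℝ => ε * (c i / (dot (γ i) p + ε * dot (γ i) (γ k)))) 0 :=
        continuousAt_id.mul (continuousAt_const.div (hcont i) (by simpa using hi))
      have h4 := h3.tendsto
      simp only [zero_mul] at h4
      rw [hL]
      exact h4.mono_left nhdsWithin_le_nhds
  have hsum : ∑ i, L i = 0 := by
    refine tendsto_nhds_unique (tendsto_finsetSum Finset.univ fun i _ => hlim i) ?_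
    refine tendsto_const_nhds.congr' ?_
    filter_upwards [Filter.eventually_all.2 hnz] with ε hε
    have h5 := h (p + ε • γ k) (fun i => by rw [hw]; exact hε i)
    simp only [hw] at h5
    rw [← Finset.mul_sum, h5, mul_zero]
  by_cases hj : ∃ j, γ j = -γ k
  · obtain ⟨j, hj⟩ := hj
    refine ⟨j, hj, ?_⟩
    have hjk : k ≠ j := by
      rintro rfl
      exact hne hj
    rw [Fintype.sum_eq_add k j hjk] at hsum
    · simp only [L, if_true, hj, if_neg hne.symm] at hsum
      linarith
    · rintro i ⟨h1, h2⟩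
      have h3 : γ i ≠ γ k := fun h => h1 (hγdist h)
      have h4 : γ i ≠ -γ k := fun h => h2 (hγdist (h.trans hj.symm))
      simp [L, h3, h4]
  · exfalso
    rw [Fintype.sum_eq_single k] at hsum
    · simp only [L, if_true] at hsum
      exact hc k hsum
    · intro i h1
      have h3 : γ i ≠ γ k := fun h => h1 (hγdist h)
      have h4 : γ i ≠ -γ k := fun h => hj ⟨i, h⟩
      simp [L, h3, h4]

/-- kernel in the symmetric case -/
lemma st_line (v : ℝ × ℝ) (hv : v ≠ 0) (f : ℝ × ℝ → ℝ) (hf : Continuous f)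
    (hfs : HasCompactSupport f) (x : ℝ × ℝ) : Integrable (fun t : ℝ => f (x + t • v)) := by
  have h1 : HasCompactSupport (fun t : ℝ => f (x + t • v)) := by
    refine hfs.comp_isClosedEmbedding ?_
    exact (Homeomorph.addLeft x).isClosedEmbedding.comp (isClosedEmbedding_smul_left hv)
  exact (by fun_prop : Continuous (fun t : ℝ => f (x + t • v))).integrable_of_hasCompactSupport h1

lemma st_ker {ι : Type*} [DecidableEq ι] (γ : ι → ℝ × ℝ) (hγ : ∀ i, γ i ≠ 0) (S : Finset ι) :
    ∃ f : ℝ × ℝ → ℝ, Continuous f ∧ HasCompactSupport f ∧ f ≠ 0 ∧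
      ∀ i ∈ S, ∀ x, ∫ t : ℝ, f (x + t • γ i) = 0 := by
  induction S using Finset.induction_on with
  | empty =>
    let φ : ContDiffBump (0 : ℝ × ℝ) := default
    refine ⟨φ, φ.continuous, φ.hasCompactSupport, ?_, by simp⟩
    intro h
    have h1 : φ 0 = 1 := φ.one_of_mem_closedBall (by simp [φ.rIn_pos.le])
    rw [h] at h1
    simp at h1
  | insert k S hk ih =>
    obtain ⟨f, hf, hfs, hf0, hfi⟩ := ih
    have hfs' : HasCompactSupport (fun x => f (x + γ k)) :=
      hfs.comp_homeomorph (Homeomorph.addRight (γ k))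
    refine ⟨fun x => f x - f (x + γ k), by fun_prop, hfs.sub hfs', ?_, ?_⟩
    · intro h0
      apply hf0
      have hper : ∀ x, f (x + γ k) = f x := fun x => by
        have := congrFun h0 x
        simp only [Pi.zero_apply] at this
        linarith
      have hn : ∀ (n : ℕ) x, f (x + (n : ℝ) • γ k) = f x := by
        intro n
        induction n with
        | zero => simp
        | succ n ih =>
          intro x
          rw [← ih x, ← hper (x + (n : ℝ) • γ k)]
          congr 1; push_cast; rw [add_smul, one_smul, add_assoc]
      ext x
      by_contra hx
      have h1 : HasCompactSupport (fun t : ℝ => f (x + t • γ k)) := by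
        refine hfs.comp_isClosedEmbedding ?_
        exact (Homeomorph.addLeft x).isClosedEmbedding.comp (isClosedEmbedding_smul_left (hγ k))
      obtain ⟨R, hR⟩ := h1.isCompact.isBounded.bddAbove
      obtain ⟨n, hnR⟩ := exists_nat_gt R
      have : (n : ℝ) ∈ tsupport (fun t : ℝ => f (x + t • γ k)) := by
        apply subset_tsupport
        simp only [Function.mem_support, hn]
        exact hx
      exact absurd (hR this) (not_le.2 hnR)
    · intro i hi x
      have hi1 := st_line (γ i) (hγ i) f hf hfs x
      have hi2 := st_line (γ i) (hγ i) f hf hfs (x + γ k)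
      have e : ∀ t : ℝ, x + t • γ i + γ k = x + γ k + t • γ i := fun t => by abel
      simp only [e]
      rw [integral_sub hi1 hi2]
      rcases Finset.mem_insert.1 hi with rfl | hi
      · have h2 : ∀ t : ℝ, x + γ i + t • γ i = x + (t + 1) • γ i := fun t => by
          rw [add_smul, one_smul]; abel
        simp only [h2]
        rw [integral_add_right_eq_self (fun t : ℝ => f (x + t • γ i)) 1, sub_self]
      · rw [hfi i hi x, hfi i hi (x + γ k), sub_self]

theorem star_injective_iff_not_symmetric
    (m : ℕ) (γ : Fin m → ℝ × ℝ) (c : Fin m → ℝ)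
    (hγunit : ∀ i, (γ i).1 ^ 2 + (γ i).2 ^ 2 = 1)
    (hγdist : Function.Injective γ)
    (hc : ∀ i, c i ≠ 0) :
    (∀ f : ℝ × ℝ → ℝ, Continuous f → HasCompactSupport f →
        (∀ x, ∑ i, c i * divBeam (γ i) f x = 0) → f = 0) ↔
      ¬ IsSymmetricStar m γ c := by
  have hγ0 : ∀ i, γ i ≠ 0 := by
    intro i hi
    have := hγunit i
    simp [hi] at this
  constructor
  · rintro hinj ⟨σ, -, hσσ, hσγ, hσc⟩
    obtain ⟨f, hf, hfs, hf0, hfi⟩ := st_ker γ hγ0 Finset.univ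
    apply hf0
    refine hinj f hf hfs fun x => ?_
    have h1 : ∑ i, c i * divBeam (γ i) f x = ∑ i, c i * divBeam (-γ i) f x := by
      rw [← Equiv.sum_comp σ]
      simp only [hσγ, hσc]
    have h2 : ∀ i, divBeam (γ i) f x + divBeam (-γ i) f x = 0 := by
      intro i
      rw [← hfi i (Finset.mem_univ i) x]
      have hi := st_line (γ i) (hγ0 i) f hf hfs x
      have h3 : divBeam (-γ i) f x = ∫ t in Set.Iic (0 : ℝ), f (x + t • γ i) := by
        have := integral_comp_neg_Ioi 0 (fun t : ℝ => f (x + t • γ i))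
        simpa [divBeam] using this
      rw [h3, add_comm, divBeam]
      exact intervalIntegral.integral_Iic_add_Ioi hi.integrableOn hi.integrableOn
    have h4 : ∑ i, c i * divBeam (γ i) f x + ∑ i, c i * divBeam (-γ i) f x = 0 := by
      rw [← Finset.sum_add_distrib]
      refine Finset.sum_eq_zero fun i _ => ?_
      rw [← mul_add, h2, mul_zero]
    linarith
  · intro hns f hf hfs hS
    have hex : ∃ w : ℝ × ℝ, (∀ i, dot (γ i) w ≠ 0) ∧ ∑ i, c i / dot (γ i) w ≠ 0 := by
      by_contra hno
      push Not at hno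
      apply hns
      choose σ hσγ hσc using st_alg m γ c hγunit hγdist hc hno
      have hinv : Function.Involutive σ := by
        intro i
        apply hγdist
        rw [hσγ, hσγ, neg_neg]
      refine ⟨hinv.toPerm, ?_, hinv, hσγ, hσc⟩
      intro i hi
      have h1 := hσγ i
      have hi' : σ i = i := hi
      rw [hi'] at h1
      exact hγ0 i (self_eq_neg.1 h1)
    obtain ⟨w, hw1, hw2⟩ := hex
    let e := Complex.equivRealProdCLM
    set g : ℂ → ℂ := fun z => ((f (e z) : ℝ) : ℂ) with hg
    have hgc : Continuous g := Complex.continuous_ofReal.comp (hf.comp e.continuous)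
    have hgs : HasCompactSupport g :=
      (hfs.comp_homeomorph e.toHomeomorph).comp_left (g := fun r : ℝ => (r : ℂ)) (by simp)
    have hin : ∀ i, inner ℝ (e.symm (γ i)) (e.symm w) = dot (γ i) w := by
      intro i
      simp [e, dot, Complex.inner]
      ring
    have hg0 := st_inj m (fun i => e.symm (γ i)) c g hgc hgs (by
      intro x
      have h1 : ∀ i, ∫ t in Set.Ioi (0 : ℝ), g (x + t • e.symm (γ i)) =
          ((divBeam (γ i) f (e x) : ℝ) : ℂ) := by
        intro i
        rw [divBeam, ← integral_complex_ofReal]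
        congr 1; ext t
        simp only [hg, map_add, map_smul, ContinuousLinearEquiv.apply_symm_apply]
      simp only [h1]
      exact_mod_cast hS (e x)) (e.symm w) (fun i => by rw [hin]; exact hw1 i)
      (by simp only [hin]; exact hw2)
    ext x
    have := congrFun hg0 (e.symm x)
    simpa [hg] using this
end

section
/- Let γ_1, …, γ_m be distinct unit vectors in ℝ² and c_1, …, c_m nonzero reals, with m odd. Then the star transform S f = ∑_{i=1}^m c_i X_{γ_i} f is injective on continuous compactly supported functions f : ℝ² → ℝ: if Sf = 0 then f = 0. -/
open MeasureTheory Real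

section StarAux

open Set Filter Topology

/-- unit segment average. -/
noncomputable def segAvg (γ : ℝ × ℝ) (f : ℝ × ℝ → ℝ) (x : ℝ × ℝ) : ℝ :=
  ∫ t in Set.Ioc (0 : ℝ) 1, f (x + t • γ)

/-- Fourier type transform. -/
noncomputable def fhat (L : ℝ × ℝ →L[ℝ] ℝ) (f : ℝ × ℝ → ℝ) : ℂ :=
  ∫ x, Complex.exp (L x * Complex.I) * (f x : ℂ)

lemma norm_expL (L : ℝ × ℝ →L[ℝ] ℝ) (x : ℝ × ℝ) : ‖Complex.exp (L x * Complex.I)‖ = 1 :=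
  Complex.norm_exp_ofReal_mul_I _

lemma integrable_exp_mul (L : ℝ × ℝ →L[ℝ] ℝ) {f : ℝ × ℝ → ℝ} (hf : Integrable f) :
    Integrable (fun x => Complex.exp (L x * Complex.I) * (f x : ℂ)) := by
  refine hf.ofReal.bdd_mul (c := 1) ?_ ?_
  · exact Continuous.aestronglyMeasurable (by fun_prop)
  · exact Eventually.of_forall fun x => (norm_expL L x).le

lemma line_integrable {f : ℝ × ℝ → ℝ} (hf : Continuous f) (hs : HasCompactSupport f)
    {γ : ℝ × ℝ} (hγ : γ ≠ 0) (x : ℝ × ℝ) : Integrable (fun t : ℝ => f (x + t • γ)) := by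
  have h1 : IsClosedEmbedding (fun t : ℝ => x + t • γ) :=
    (Homeomorph.addLeft x).isClosedEmbedding.comp (isClosedEmbedding_smul_left hγ)
  have h2 := hs.comp_isClosedEmbedding h1
  exact Continuous.integrable_of_hasCompactSupport (by fun_prop) h2

lemma divBeam_sub {f : ℝ × ℝ → ℝ} (hf : Continuous f) (hs : HasCompactSupport f)
    {γ : ℝ × ℝ} (hγ : γ ≠ 0) (x : ℝ × ℝ) :
    divBeam γ f x - divBeam γ f (x + γ) = segAvg γ f x := by
  have hi := line_integrable hf hs hγ x
  have h1 : divBeam γ f (x + γ) = ∫ t in Set.Ioi (1 : ℝ), f (x + t • γ) := by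
    have := (measurePreserving_add_right (volume : Measure ℝ) 1).setIntegral_preimage_emb
      (measurableEmbedding_addRight 1) (fun t : ℝ => f (x + t • γ)) (Set.Ioi 1)
    rw [← this]
    unfold divBeam
    have h0 : (fun t : ℝ => t + 1) ⁻¹' Set.Ioi 1 = Set.Ioi 0 := by ext t; simp
    rw [h0]
    congr 1
    ext t
    congr 1
    rw [add_smul, one_smul]; abel
  rw [h1]
  unfold divBeam segAvg
  rw [← Ioc_union_Ioi_eq_Ioi (zero_le_one' ℝ), setIntegral_union (Set.Ioc_disjoint_Ioi le_rfl)
    measurableSet_Ioi hi.integrableOn hi.integrableOn]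
  ring

lemma fhat_translate (L : ℝ × ℝ →L[ℝ] ℝ) (f : ℝ × ℝ → ℝ) (v : ℝ × ℝ) :
    fhat L (fun x => f (x + v)) = Complex.exp (-(L v * Complex.I)) * fhat L f := by
  unfold fhat
  rw [← integral_const_mul, ← integral_add_right_eq_self
    (fun x => Complex.exp (-(L v * Complex.I)) * (Complex.exp (L x * Complex.I) * (f x : ℂ))) v]
  congr 1
  ext x
  rw [← mul_assoc, ← Complex.exp_add]
  congr 2
  rw [map_add]; push_cast; ring

lemma prod_integrable {f : ℝ × ℝ → ℝ} (hf : Continuous f) (hs : HasCompactSupport f)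
    (γ : ℝ × ℝ) :
    Integrable (fun p : (ℝ × ℝ) × ℝ => f (p.1 + p.2 • γ))
      ((volume : Measure (ℝ × ℝ)).prod (volume.restrict (Set.Ioc (0 : ℝ) 1))) := by
  have hfi : Integrable f := hf.integrable_of_hasCompactSupport hs
  rw [integrable_prod_iff' (Continuous.aestronglyMeasurable (by fun_prop))]
  refine ⟨Eventually.of_forall fun t => hfi.comp_add_right (t • γ), ?_⟩
  have : (fun t : ℝ => ∫ x : ℝ × ℝ, ‖f (x + t • γ)‖) = fun _ => ∫ x : ℝ × ℝ, ‖f x‖ := by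
    ext t
    exact integral_add_right_eq_self (fun x => ‖f x‖) (t • γ)
  simp only [this]
  exact integrable_const _

lemma segAvg_integrable {f : ℝ × ℝ → ℝ} (hf : Continuous f) (hs : HasCompactSupport f)
    (γ : ℝ × ℝ) : Integrable (segAvg γ f) :=
  (prod_integrable hf hs γ).integral_prod_left

lemma fhat_segAvg (L : ℝ × ℝ →L[ℝ] ℝ) {f : ℝ × ℝ → ℝ} (hf : Continuous f)
    (hs : HasCompactSupport f) (γ : ℝ × ℝ) :
    (L γ : ℂ) * Complex.I * fhat L (segAvg γ f)
      = (1 - Complex.exp (-(L γ * Complex.I))) * fhat L f := by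
  have h1 : fhat L (segAvg γ f)
      = ∫ t in Set.Ioc (0:ℝ) 1, fhat L (fun x => f (x + t • γ)) := by
    unfold fhat segAvg
    rw [← integral_integral_swap]
    · congr 1
      ext x
      rw [← integral_complex_ofReal, integral_const_mul]
    · refine (prod_integrable hf hs γ).ofReal.bdd_mul (c := 1)
        (f := fun p : (ℝ × ℝ) × ℝ => Complex.exp (L p.1 * Complex.I)) ?_ ?_
      · exact Continuous.aestronglyMeasurable (by fun_prop)
      · exact Eventually.of_forall fun x => (norm_expL L x.1).le
  rw [h1]
  simp_rw [fhat_translate]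
  rw [integral_mul_const, ← intervalIntegral.integral_of_le zero_le_one, ← mul_assoc]
  congr 1
  by_cases h0 : L γ = 0
  · simp [h0]
  have hne : -((L γ : ℂ) * Complex.I) ≠ 0 := by simp [h0]
  have := integral_exp_mul_complex (a := 0) (b := 1) hne
  have h2 : (fun t : ℝ => Complex.exp (-(L (t • γ) * Complex.I)))
      = fun t : ℝ => Complex.exp (-((L γ : ℂ) * Complex.I) * t) := by
    ext t
    congr 1
    rw [map_smul]; simp; ring
  rw [h2, this]
  have hne' : (L γ : ℂ) ≠ 0 := by simpa using h0
  simp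
  field_simp
  ring

lemma fhat_continuous {f : ℝ × ℝ → ℝ} (hf : Integrable f) :
    Continuous (fun L : ℝ × ℝ →L[ℝ] ℝ => fhat L f) := by
  unfold fhat
  refine continuous_of_dominated (bound := fun x => ‖f x‖) ?_ ?_ hf.norm ?_
  · intro L
    exact (integrable_exp_mul L hf).aestronglyMeasurable
  · intro L
    refine Eventually.of_forall fun x => ?_
    rw [norm_mul, norm_expL]; simp
  · refine Eventually.of_forall fun x => ?_
    fun_prop

lemma eq_zero_of_fhat {f : ℝ × ℝ → ℝ} (hf : Continuous f) (hi : Integrable f)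
    (h : ∀ L, fhat L f = 0) : f = 0 := by
  let p : ℝ × ℝ → NNReal := fun x => (f x).toNNReal
  let q : ℝ × ℝ → NNReal := fun x => (-f x).toNNReal
  have hpc : Continuous p := by fun_prop
  have hqc : Continuous q := by fun_prop
  have hpi : Integrable (fun x => (p x : ℝ)) := by
    simpa [p] using hi.real_toNNReal
  have hqi : Integrable (fun x => (q x : ℝ)) := by
    simpa [q] using hi.neg.real_toNNReal
  have : IsFiniteMeasure ((volume : Measure (ℝ × ℝ)).withDensity (fun x => (p x : ENNReal))) :=
    isFiniteMeasure_withDensity_ofReal hi.2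
  have : IsFiniteMeasure ((volume : Measure (ℝ × ℝ)).withDensity (fun x => (q x : ENNReal))) :=
    isFiniteMeasure_withDensity_ofReal hi.neg.2
  have key : (volume : Measure (ℝ × ℝ)).withDensity (fun x => (p x : ENNReal))
      = (volume : Measure (ℝ × ℝ)).withDensity (fun x => (q x : ENNReal)) := by
    apply Measure.ext_of_charFunDual
    ext L
    rw [charFunDual_apply, charFunDual_apply,
      integral_withDensity_eq_integral_smul hpc.measurable,
      integral_withDensity_eq_integral_smul hqc.measurable, ← sub_eq_zero, ← integral_sub]
    · rw [← h L]
      unfold fhat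
      congr 1
      ext x
      have : (f x : ℂ) = ((p x : ℝ) : ℂ) - ((q x : ℝ) : ℂ) := by
        rw [← Complex.ofReal_sub]
        congr 1
        simp only [p, q, Real.coe_toNNReal']
        rcases le_total 0 (f x) with h | h <;> simp [h]
      rw [this, NNReal.smul_def, NNReal.smul_def, Complex.real_smul, Complex.real_smul]
      ring
    · refine (integrable_exp_mul L hpi).congr (Eventually.of_forall fun x => ?_)
      simp only [NNReal.smul_def, Complex.real_smul]; ring
    · refine (integrable_exp_mul L hqi).congr (Eventually.of_forall fun x => ?_)
      simp only [NNReal.smul_def, Complex.real_smul]; ring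
  have hae := (withDensity_eq_iff_of_sigmaFinite (μ := (volume : Measure (ℝ × ℝ)))
    hpc.measurable.coe_nnreal_ennreal.aemeasurable
    hqc.measurable.coe_nnreal_ennreal.aemeasurable).1 key
  have heq := (Continuous.ae_eq_iff_eq volume (ENNReal.continuous_coe.comp hpc)
    (ENNReal.continuous_coe.comp hqc)).1 hae
  ext x
  have hx := congrFun heq x
  have hx' : p x = q x := by simpa using hx
  have hx2 : max (f x) 0 = max (-f x) 0 := by
    have := congrArg NNReal.toReal hx'
    simpa [p, q, Real.coe_toNNReal'] using this
  simp only [Pi.zero_apply]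
  rcases le_total 0 (f x) with h | h
  · rw [max_eq_left h, max_eq_right (by linarith)] at hx2; exact hx2
  · rw [max_eq_right h, max_eq_left (by linarith)] at hx2; linarith

lemma dense_ne_zero {V : Type*} [NormedAddCommGroup V] [NormedSpace ℝ V] {p : V → ℂ}
    (hp : AnalyticOnNhd ℝ p Set.univ) (v : V) (hv : p v ≠ 0) : Dense {x | p x ≠ 0} := by
  intro x
  by_contra hx
  have h1 : p =ᶠ[𝓝 x] 0 := by
    have := isClosed_closure.isOpen_compl.mem_nhds hx
    filter_upwards [this] with y hy
    by_contra h
    exact hy (subset_closure h)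
  exact hv (hp.eqOn_zero_of_preconnected_of_eventuallyEq_zero isPreconnected_univ
    (mem_univ x) h1 (mem_univ v))

lemma fhat_sum {ι : Type*} (s : Finset ι) (L : ℝ × ℝ →L[ℝ] ℝ) (a : ι → ℝ) (g : ι → ℝ × ℝ → ℝ)
    (hg : ∀ i, Integrable (g i)) :
    fhat L (fun x => ∑ i ∈ s, a i * g i x) = ∑ i ∈ s, (a i : ℂ) * fhat L (g i) := by
  unfold fhat
  simp_rw [← integral_const_mul]
  rw [← integral_finsetSum]
  · congr 1
    ext x
    push_cast
    rw [Finset.mul_sum]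
    refine Finset.sum_congr rfl fun i _ => ?_
    ring
  · intro i _
    exact (integrable_exp_mul L (hg i)).const_mul _

lemma fhat_diff {ι : Type*} (s : Finset ι) (L : ℝ × ℝ →L[ℝ] ℝ) (γ : ι → ℝ × ℝ)
    (g : ℝ × ℝ → ℝ) (hg : Integrable g) :
    fhat L (fun x => ∑ t ∈ s.powerset, (-1) ^ t.card * g (x + ∑ j ∈ t, γ j))
      = (∏ j ∈ s, (1 - Complex.exp (-(L (γ j) * Complex.I)))) * fhat L g := by
  rw [fhat_sum s.powerset L (fun t => (-1) ^ t.card) (fun t x => g (x + ∑ j ∈ t, γ j))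
    (fun t => hg.comp_add_right _)]
  simp_rw [fhat_translate, sub_eq_add_neg]
  rw [Finset.prod_one_add, Finset.sum_mul]
  refine Finset.sum_congr rfl fun t _ => ?_
  rw [Finset.prod_neg, ← Complex.exp_sum, ← mul_assoc, map_sum]
  push_cast
  rw [Finset.sum_neg_distrib, Finset.sum_mul]

lemma diff_identity {m : ℕ} {γ : Fin m → ℝ × ℝ} {c : Fin m → ℝ} (hγ : ∀ i, γ i ≠ 0)
    {f : ℝ × ℝ → ℝ} (hf : Continuous f) (hs : HasCompactSupport f)
    (h : ∀ x, ∑ i, c i * divBeam (γ i) f x = 0) (x : ℝ × ℝ) :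
    ∑ i, c i * ∑ t ∈ (Finset.univ.erase i).powerset,
      (-1) ^ t.card * segAvg (γ i) f (x + ∑ j ∈ t, γ j) = 0 := by
  have h1 : ∑ t ∈ (Finset.univ : Finset (Fin m)).powerset, (-1 : ℝ) ^ t.card *
      ∑ i, c i * divBeam (γ i) f (x + ∑ j ∈ t, γ j) = 0 := by
    simp [h]
  rw [← h1]
  simp_rw [Finset.mul_sum]
  rw [Finset.sum_comm (s := (Finset.univ : Finset (Fin m)).powerset)]
  refine Finset.sum_congr rfl fun i _ => ?_
  conv_rhs => rw [← Finset.insert_erase (Finset.mem_univ i)]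
  rw [Finset.sum_powerset_insert (Finset.notMem_erase i _), ← Finset.sum_add_distrib]
  refine Finset.sum_congr rfl fun t ht => ?_
  have hit : i ∉ t := fun hi => Finset.notMem_erase i _ (Finset.mem_powerset.1 ht hi)
  rw [Finset.card_insert_of_notMem hit, Finset.sum_insert hit, ← divBeam_sub hf hs (hγ i),
    pow_succ, show x + (γ i + ∑ j ∈ t, γ j) = x + ∑ j ∈ t, γ j + γ i by abel]
  ring

/-- The symbol polynomial. -/
noncomputable def symb {m : ℕ} (γ : Fin m → ℝ × ℝ) (c : Fin m → ℝ) (L : ℝ × ℝ →L[ℝ] ℝ) : ℂ :=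
  ∑ i, (c i : ℂ) * ∏ j ∈ Finset.univ.erase i, (L (γ j) : ℂ)

lemma symb_mul {m : ℕ} {γ : Fin m → ℝ × ℝ} {c : Fin m → ℝ} (hγ : ∀ i, γ i ≠ 0)
    {f : ℝ × ℝ → ℝ} (hf : Continuous f) (hs : HasCompactSupport f)
    (h : ∀ x, ∑ i, c i * divBeam (γ i) f x = 0) (L : ℝ × ℝ →L[ℝ] ℝ) :
    symb γ c L * (∏ j, (1 - Complex.exp (-(L (γ j) * Complex.I)))) * fhat L f = 0 := by
  have h1 : ∑ i, (c i : ℂ) * ((∏ j ∈ Finset.univ.erase i,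
      (1 - Complex.exp (-(L (γ j) * Complex.I)))) * fhat L (segAvg (γ i) f)) = 0 := by
    have hsum := fhat_sum (Finset.univ : Finset (Fin m)) L c
      (fun i x => ∑ t ∈ (Finset.univ.erase i).powerset,
        (-1) ^ t.card * segAvg (γ i) f (x + ∑ j ∈ t, γ j))
      (fun i => integrable_finsetSum _ fun t _ =>
        ((segAvg_integrable hf hs (γ i)).comp_add_right _).const_mul _)
    simp_rw [diff_identity hγ hf hs h] at hsum
    simp_rw [fun i => fhat_diff (Finset.univ.erase i) L γ _ (segAvg_integrable hf hs (γ i))] at hsum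
    rw [← hsum]
    simp [fhat]
  have h2 := congrArg (fun z => (∏ j, (L (γ j) : ℂ)) * Complex.I * z) h1
  simp only [mul_zero] at h2
  rw [← h2, symb, Finset.sum_mul, Finset.sum_mul, Finset.mul_sum]
  refine Finset.sum_congr rfl fun i _ => ?_
  rw [← Finset.mul_prod_erase Finset.univ
    (fun j => (1 - Complex.exp (-(L (γ j) * Complex.I)))) (Finset.mem_univ i),
    ← Finset.mul_prod_erase Finset.univ (fun j => (L (γ j) : ℂ)) (Finset.mem_univ i)]
  linear_combination (-(c i : ℂ) * (∏ j ∈ Finset.univ.erase i, (L (γ j) : ℂ)) *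
    (∏ j ∈ Finset.univ.erase i, (1 - Complex.exp (-(L (γ j) * Complex.I))))) *
    fhat_segAvg L hf hs (γ i)

lemma exists_unpaired {m : ℕ} (hm : Odd m) {γ : Fin m → ℝ × ℝ} (hγ : ∀ i, γ i ≠ 0)
    (hinj : Function.Injective γ) : ∃ i, ∀ j, γ j ≠ -γ i := by
  by_contra hcon
  push Not at hcon
  choose g hg using hcon
  have hgg : ∀ i, g (g i) = i := fun i => hinj (by rw [hg, hg, neg_neg])
  have hne : ∀ i, g i ≠ i := fun i hi => by
    have := hg i
    rw [hi] at this
    exact hγ i (self_eq_neg.1 this)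
  have hsum : ∑ _i : Fin m, (1 : ZMod 2) = 0 :=
    Finset.sum_involution (fun i _ => g i) (fun _ _ => by decide) (fun i _ _ => hne i)
      (fun _ _ => Finset.mem_univ _) (fun i _ => hgg i)
  simp only [Finset.sum_const, Finset.card_univ, Fintype.card_fin, nsmul_eq_mul, mul_one] at hsum
  rw [ZMod.natCast_eq_zero_iff] at hsum
  exact (Nat.not_even_iff_odd.2 hm) (even_iff_two_dvd.2 hsum)

lemma cross_ne {u v : ℝ × ℝ} (hu : u.1 ^ 2 + u.2 ^ 2 = 1) (hv : v.1 ^ 2 + v.2 ^ 2 = 1)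
    (h1 : v ≠ u) (h2 : v ≠ -u) : u.1 * v.2 - u.2 * v.1 ≠ 0 := by
  intro h
  have hd : (u.1 * v.1 + u.2 * v.2 - 1) * (u.1 * v.1 + u.2 * v.2 + 1) = 0 := by
    linear_combination (v.1 ^ 2 + v.2 ^ 2) * hu + hv - (u.1 * v.2 - u.2 * v.1) * h
  rcases mul_eq_zero.1 hd with hd | hd
  · apply h1
    ext
    · linear_combination u.1 * hd - u.2 * h - v.1 * hu
    · linear_combination u.2 * hd + u.1 * h - v.2 * hu
  · apply h2
    ext
    · simp only [Prod.fst_neg]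
      linear_combination u.1 * hd - u.2 * h - v.1 * hu
    · simp only [Prod.snd_neg]
      linear_combination u.2 * hd + u.1 * h - v.2 * hu

lemma symb_ne {m : ℕ} (hm : Odd m) {γ : Fin m → ℝ × ℝ} {c : Fin m → ℝ}
    (hγunit : ∀ i, (γ i).1 ^ 2 + (γ i).2 ^ 2 = 1) (hγ : ∀ i, γ i ≠ 0)
    (hinj : Function.Injective γ) (hc : ∀ i, c i ≠ 0) : ∃ L, symb γ c L ≠ 0 := by
  obtain ⟨i, hi⟩ := exists_unpaired hm hγ hinj
  let L : ℝ × ℝ →L[ℝ] ℝ := (γ i).1 • ContinuousLinearMap.snd ℝ ℝ ℝ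
    - (γ i).2 • ContinuousLinearMap.fst ℝ ℝ ℝ
  have hL : ∀ v, L v = (γ i).1 * v.2 - (γ i).2 * v.1 := fun v => by simp [L]
  refine ⟨L, ?_⟩
  unfold symb
  rw [Finset.sum_eq_single i]
  · refine mul_ne_zero (by exact_mod_cast hc i) (Finset.prod_ne_zero_iff.2 fun j hj => ?_)
    rw [hL]
    exact_mod_cast cross_ne (hγunit i) (hγunit j)
      (fun h => (Finset.mem_erase.1 hj).1 (hinj h)) (hi j)
  · intro k _ hk
    rw [Finset.prod_eq_zero (Finset.mem_erase.2 ⟨hk.symm, Finset.mem_univ i⟩), mul_zero]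
    rw [hL]
    push_cast
    ring
  · simp

lemma analytic_coord (v : ℝ × ℝ) :
    AnalyticOnNhd ℝ (fun L : ℝ × ℝ →L[ℝ] ℝ => (L v : ℂ)) Set.univ := fun L _ =>
  (Complex.ofRealCLM.comp (ContinuousLinearMap.apply ℝ ℝ v)).analyticAt L

lemma analytic_symb {m : ℕ} (γ : Fin m → ℝ × ℝ) (c : Fin m → ℝ) :
    AnalyticOnNhd ℝ (symb γ c) Set.univ := fun L _ => by
  unfold symb
  refine Finset.analyticAt_fun_sum _ fun i _ => analyticAt_const.mul
    (Finset.analyticAt_fun_prod _ fun j _ => analytic_coord (γ j) L (mem_univ _))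

lemma analytic_exp (v : ℝ × ℝ) : AnalyticOnNhd ℝ
    (fun L : ℝ × ℝ →L[ℝ] ℝ => 1 - Complex.exp (-(L v * Complex.I))) Set.univ := fun L _ =>
  analyticAt_const.sub
    (((analyticAt_cexp).restrictScalars (𝕜 := ℝ)).comp'
      ((analytic_coord v L (mem_univ _)).mul analyticAt_const).neg)

lemma exp_ne {v : ℝ × ℝ} (hv : v.1 ^ 2 + v.2 ^ 2 = 1) : ∃ L : ℝ × ℝ →L[ℝ] ℝ,
    1 - Complex.exp (-(L v * Complex.I)) ≠ 0 := by
  let L : ℝ × ℝ →L[ℝ] ℝ := v.1 • ContinuousLinearMap.fst ℝ ℝ ℝ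
    + v.2 • ContinuousLinearMap.snd ℝ ℝ ℝ
  have hL : L v = 1 := by rw [← hv]; simp [L]; ring
  refine ⟨L, fun h => ?_⟩
  rw [hL] at h
  have := congrArg Complex.im h
  have hpos : 0 < Real.sin 1 := Real.sin_pos_of_pos_of_lt_pi one_pos (by linarith [Real.pi_gt_three])
  simp [Complex.exp_im] at this
  linarith

end StarAux

theorem star_injective_of_odd
    (m : ℕ) (hm : Odd m) (γ : Fin m → ℝ × ℝ) (c : Fin m → ℝ)
    (hγunit : ∀ i, (γ i).1 ^ 2 + (γ i).2 ^ 2 = 1)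
    (hγdist : Function.Injective γ)
    (hc : ∀ i, c i ≠ 0) :
    ∀ f : ℝ × ℝ → ℝ, Continuous f → HasCompactSupport f →
      (∀ x, ∑ i, c i * divBeam (γ i) f x = 0) → f = 0 := by
  intro f hf hs h
  have hγ : ∀ i, γ i ≠ 0 := fun i hi => by
    have := hγunit i
    rw [hi] at this
    simp at this
  have hfi : Integrable f := hf.integrable_of_hasCompactSupport hs
  refine eq_zero_of_fhat hf hfi fun L => ?_
  obtain ⟨L₁, hL₁⟩ := symb_ne hm hγunit hγ hγdist hc
  have hd1 := dense_ne_zero (analytic_symb γ c) L₁ hL₁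
  have hd2 : Dense (⋂ j, {L : ℝ × ℝ →L[ℝ] ℝ | 1 - Complex.exp (-(L (γ j) * Complex.I)) ≠ 0}) := by
    refine dense_iInter_of_isOpen (fun j => ?_) (fun j => ?_)
    · exact isOpen_ne_fun (continuousOn_univ.1 (analytic_exp (γ j)).continuousOn)
        continuous_const
    · obtain ⟨L₂, hL₂⟩ := exp_ne (hγunit j)
      exact dense_ne_zero (analytic_exp (γ j)) L₂ hL₂
  have hd := hd1.inter_of_isOpen_left hd2
    (isOpen_ne_fun (continuousOn_univ.1 (analytic_symb γ c).continuousOn) continuous_const)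
  have hz : (fun L : ℝ × ℝ →L[ℝ] ℝ => fhat L f) = fun _ => 0 := by
    refine Continuous.ext_on hd (fhat_continuous hfi) continuous_const ?_
    rintro M ⟨hM1, hM2⟩
    have hM2' := Set.mem_iInter.1 hM2
    rcases mul_eq_zero.1 (symb_mul hγ hf hs h M) with h0 | h0
    · rcases mul_eq_zero.1 h0 with h0 | h0
      · exact absurd h0 hM1
      · obtain ⟨j, _, hj⟩ := Finset.prod_eq_zero_iff.1 h0
        exact absurd hj (hM2' j)
    · exact h0
  exact congrFun hz L
end

section
/- Let γ_1, …, γ_m be distinct unit vectors in ℝ² and c_1, …, c_m nonzero reals. If ∑_{j=1}^m c_j ∏_{i≠j} ⟨ψ, γ_i⟩ = 0 for every unit vector ψ ∈ ℝ², then m is even, say m = 2k, and the indices {1,…,m} can be partitioned into k pairs {i, j} such that γ_i = −γ_j and c_i = c_j. -/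
open Real

lemma parallel_aux (u v : ℝ × ℝ) (hu : u.1 ^ 2 + u.2 ^ 2 = 1) (hv : v.1 ^ 2 + v.2 ^ 2 = 1)
    (h : dot (-u.2, u.1) v = 0) : v = u ∨ v = -u := by
  obtain ⟨a, b⟩ := u
  obtain ⟨x, y⟩ := v
  simp only [dot] at *
  have e1 : x = (a * x + b * y) * a := by linear_combination (-x) * hu - b * h
  have e2 : y = (a * x + b * y) * b := by linear_combination (-y) * hu + a * h
  have e3 : (a * x + b * y - 1) * (a * x + b * y + 1) = 0 := by
    linear_combination (x ^ 2 + y ^ 2) * hu + hv - h * (-b * x + a * y)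
  rcases mul_eq_zero.1 e3 with h3 | h3
  · left
    have : a * x + b * y = 1 := by linarith
    rw [this] at e1 e2
    ext <;> simp <;> linarith
  · right
    have : a * x + b * y = -1 := by linarith
    rw [this] at e1 e2
    ext <;> simp <;> linarith

lemma weights_aux
    (m : ℕ) (γ : Fin m → ℝ × ℝ) (c : Fin m → ℝ)
    (hγunit : ∀ i, (γ i).1 ^ 2 + (γ i).2 ^ 2 = 1)
    (hγdist : Function.Injective γ)
    (hvanish : ∀ ψ : ℝ × ℝ, ψ.1 ^ 2 + ψ.2 ^ 2 = 1 →
      ∑ j, c j * ∏ i ∈ Finset.univ.erase j, dot ψ (γ i) = 0)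
    (i p : Fin m) (hip : p ≠ i) (hp : γ p = -γ i) : c p = c i := by
  classical
  let ψ : ℝ → ℝ × ℝ := fun t =>
    (-cos t * (γ i).2 + sin t * (γ i).1, cos t * (γ i).1 + sin t * (γ i).2)
  have hu := hγunit i
  have hψ : ∀ t, (ψ t).1 ^ 2 + (ψ t).2 ^ 2 = 1 := by
    intro t
    simp only [ψ]
    linear_combination (cos t ^ 2 + sin t ^ 2) * hu + sin_sq_add_cos_sq t
  have hdi : ∀ t, dot (ψ t) (γ i) = sin t := by
    intro t
    simp only [ψ, dot]
    linear_combination sin t * hu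
  have hdp : ∀ t, dot (ψ t) (γ p) = - sin t := by
    intro t
    rw [← hdi t, hp]
    simp only [dot, Prod.fst_neg, Prod.snd_neg]
    ring
  let S : Finset (Fin m) := (Finset.univ.erase i).erase p
  have hpS : p ∈ Finset.univ.erase i := by simp [hip]
  let Q : ℝ → ℝ := fun t => ∏ k ∈ S, dot (ψ t) (γ k)
  let R : ℝ → ℝ := fun t => ∑ j ∈ S, c j * ∏ k ∈ S.erase j, dot (ψ t) (γ k)
  let F : ℝ → ℝ := fun t => (c p - c i) * Q t - sin t * R t
  have hF : ∀ t, sin t * F t = 0 := by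
    intro t
    have h := hvanish (ψ t) (hψ t)
    rw [← Finset.add_sum_erase _ _ (Finset.mem_univ i), ← Finset.add_sum_erase _ _ hpS,
      ← Finset.mul_prod_erase _ _ hpS,
      ← Finset.mul_prod_erase (Finset.univ.erase p) _ (a := i) (by simp [hip.symm]),
      Finset.erase_right_comm (a := p) (b := i)] at h
    have h2 : ∑ j ∈ (Finset.univ.erase i).erase p,
        c j * ∏ k ∈ Finset.univ.erase j, dot (ψ t) (γ k) = - sin t ^ 2 * R t := by
      simp only [R]
      rw [Finset.mul_sum]
      refine Finset.sum_congr rfl fun j hj => ?_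
      have hj' : j ≠ p ∧ j ≠ i := by simpa [S] using hj
      rw [← Finset.mul_prod_erase (Finset.univ.erase j) _ (a := i) (by simp [hj'.2.symm]),
        ← Finset.mul_prod_erase ((Finset.univ.erase j).erase i) _ (a := p)
          (by simp [hj'.1.symm, hip]), hdi, hdp,
        Finset.erase_right_comm (a := j) (b := i), Finset.erase_right_comm (a := j) (b := p)]
      ring
    rw [h2, hdi, hdp] at h
    simp only [F]
    linear_combination h
  have hdc : ∀ k, Continuous fun t => dot (ψ t) (γ k) := by
    intro k
    simp only [dot, ψ]
    fun_prop
  have hFc : Continuous F := by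
    have hQ : Continuous Q := continuous_finsetProd _ fun k _ => hdc k
    have hR : Continuous R := continuous_finsetSum _ fun j _ =>
      continuous_const.mul (continuous_finsetProd _ fun k _ => hdc k)
    exact (continuous_const.mul hQ).sub (continuous_sin.mul hR)
  have hF0 : F 0 = 0 := by
    have h1 : Filter.Tendsto F (nhdsWithin 0 (Set.Ioi 0)) (nhds (F 0)) :=
      hFc.continuousAt.mono_left nhdsWithin_le_nhds
    have h2 : F =ᶠ[nhdsWithin 0 (Set.Ioi 0)] fun _ => 0 := by
      filter_upwards [Ioo_mem_nhdsGT pi_pos] with t ht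
      exact (mul_eq_zero.1 (hF t)).resolve_left (sin_pos_of_pos_of_lt_pi ht.1 ht.2).ne'
    exact tendsto_nhds_unique (h1.congr' h2) tendsto_const_nhds
  have hQ0 : Q 0 ≠ 0 := by
    refine Finset.prod_ne_zero_iff.2 fun k hk h0 => ?_
    have hk' : k ≠ p ∧ k ≠ i := by simpa [S] using hk
    rcases parallel_aux (γ i) (γ k) hu (hγunit k) (by simpa [ψ] using h0) with h | h
    · exact hk'.2 (hγdist h)
    · exact hk'.1 (hγdist (h.trans hp.symm))
  simp only [F, sin_zero, zero_mul, sub_zero] at hF0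
  exact sub_eq_zero.1 ((mul_eq_zero.1 hF0).resolve_right hQ0)

theorem symmetric_of_vanishing_polynomial
    (m : ℕ) (γ : Fin m → ℝ × ℝ) (c : Fin m → ℝ)
    (hγunit : ∀ i, (γ i).1 ^ 2 + (γ i).2 ^ 2 = 1)
    (hγdist : Function.Injective γ)
    (hc : ∀ i, c i ≠ 0)
    (hvanish : ∀ ψ : ℝ × ℝ, ψ.1 ^ 2 + ψ.2 ^ 2 = 1 →
      ∑ j, c j * ∏ i ∈ Finset.univ.erase j, dot ψ (γ i) = 0) :
    (∃ k, m = 2 * k) ∧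
      ∃ σ : Equiv.Perm (Fin m),
        (∀ i, σ i ≠ i) ∧ (∀ i, σ (σ i) = i) ∧
        (∀ i, γ (σ i) = -γ i) ∧ (∀ i, c (σ i) = c i) := by
  have hex : ∀ i, ∃ p, p ≠ i ∧ γ p = -γ i := by
    intro i
    have h := hvanish (-(γ i).2, (γ i).1) (by linear_combination hγunit i)
    rw [Finset.sum_eq_single i] at h
    · have h' := (mul_eq_zero.1 h).resolve_left (hc i)
      obtain ⟨k, hk, hk0⟩ := Finset.prod_eq_zero_iff.1 h'
      have hki : k ≠ i := by simpa using hk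
      refine ⟨k, hki, ?_⟩
      exact (parallel_aux _ _ (hγunit i) (hγunit k) hk0).resolve_left fun h => hki (hγdist h)
    · intro j _ hj
      rw [Finset.prod_eq_zero (i := i) (by simp [hj.symm]) (by simp only [dot]; ring), mul_zero]
    · simp
  choose f hf1 hf2 using hex
  have hinv : Function.Involutive f := fun i => hγdist (by rw [hf2, hf2, neg_neg])
  have key : ∃ σ : Equiv.Perm (Fin m), ∀ i, σ i = f i := ⟨hinv.toPerm, fun _ => rfl⟩
  obtain ⟨σ, hσ⟩ := key
  refine ⟨?_, σ, fun i => by rw [hσ]; exact hf1 i, fun i => by rw [hσ, hσ]; exact hinv i,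
    fun i => by rw [hσ]; exact hf2 i, fun i => by
      rw [hσ]; exact weights_aux m γ c hγunit hγdist hvanish i (f i) (hf1 i) (hf2 i)⟩
  have h2 : σ ^ 2 = 1 := by
    ext i
    simp [pow_two, hσ, hinv i]
  have h3 := Equiv.Perm.two_dvd_card_support h2
  have h4 : σ.support = Finset.univ := by
    ext i
    simp [hσ, hf1 i]
  rw [h4, Finset.card_univ, Fintype.card_fin] at h3
  exact h3
end

section
/- Let m be even, let γ_1, …, γ_m be distinct unit vectors in ℝ², and let c_1, …, c_m be nonzero reals. Then the star transform with rays γ_1,…,γ_m and weights c_1,…,c_m has a singular direction of Type 2: there exists a unit vector ψ ∈ ℝ² with ∑_{j=1}^m c_j ∏_{i≠j} ⟨ψ, γ_i⟩ = 0. -/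
open Real

theorem even_star_has_type2_singular_direction
    (m : ℕ) (hm : Even m) (γ : Fin m → ℝ × ℝ) (c : Fin m → ℝ)
    (hγunit : ∀ i, (γ i).1 ^ 2 + (γ i).2 ^ 2 = 1)
    (hγdist : Function.Injective γ)
    (hc : ∀ i, c i ≠ 0) :
    ∃ ψ : ℝ × ℝ, ψ.1 ^ 2 + ψ.2 ^ 2 = 1 ∧
      ∑ j, c j * ∏ i ∈ Finset.univ.erase j, dot ψ (γ i) = 0 := by
  let f : ℝ → ℝ := fun t =>
    ∑ j, c j * ∏ i ∈ Finset.univ.erase j, dot (Real.cos t, Real.sin t) (γ i)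
  have hf : Continuous f := by
    simp only [f, dot]
    fun_prop
  have hneg : f Real.pi = - f 0 := by
    simp only [f]
    rw [← Finset.sum_neg_distrib]
    refine Finset.sum_congr rfl fun j _ => ?_
    have hodd : Odd (Finset.univ.erase j).card := by
      rw [Finset.card_erase_of_mem (Finset.mem_univ j), Finset.card_univ, Fintype.card_fin]
      have := j.pos
      exact Nat.Even.sub_odd this hm odd_one
    have h : ∀ i, dot (Real.cos Real.pi, Real.sin Real.pi) (γ i)
        = - dot (Real.cos 0, Real.sin 0) (γ i) := by
      intro i
      simp [dot]
    simp only [h]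
    rw [Finset.prod_neg, hodd.neg_one_pow]
    ring
  have h0 : ∃ t, f t = 0 := by
    rcases le_total (f 0) 0 with h | h
    · exact mem_range_of_exists_le_of_exists_ge hf ⟨0, h⟩ ⟨Real.pi, by linarith⟩
    · exact mem_range_of_exists_le_of_exists_ge hf ⟨Real.pi, by linarith⟩ ⟨0, h⟩
  obtain ⟨t, ht⟩ := h0
  exact ⟨(Real.cos t, Real.sin t), Real.cos_sq_add_sin_sq t, ht⟩
end

section
/- Let m = 2k+1 with k ≥ 1, and let γ_1, …, γ_m be distinct unit vectors in ℝ² all lying in a common open half-plane, i.e., there is a unit vector n ∈ ℝ² with ⟨γ_i, n⟩ < 0 for all i = 1,…,m. Then the star transform with rays γ_1,…,γ_m and uniform weights c_1 = … = c_m = 1 has a singular direction of Type 2: there exists a unit vector ψ ∈ ℝ² with ∑_{j=1}^m ∏_{i≠j} ⟨ψ, γ_i⟩ = 0. -/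
open Real

lemma exists_angle (u : ℝ × ℝ) (hu : u.1 ^ 2 + u.2 ^ 2 = 1) :
    ∃ t : ℝ, u = (cos t, sin t) := by
  have hz : ‖(⟨u.1, u.2⟩ : ℂ)‖ = 1 := by
    rw [Complex.norm_def, Complex.normSq_mk, ← sq, ← sq, hu, Real.sqrt_one]
  refine ⟨Complex.arg ⟨u.1, u.2⟩, ?_⟩
  have h1 := Complex.norm_mul_cos_arg (⟨u.1, u.2⟩ : ℂ)
  have h2 := Complex.norm_mul_sin_arg (⟨u.1, u.2⟩ : ℂ)
  rw [hz, one_mul] at h1 h2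
  exact Prod.ext h1.symm h2.symm

theorem halfplane_star_has_type2_singular_direction
    (k : ℕ) (hk : 1 ≤ k) (γ : Fin (2 * k + 1) → ℝ × ℝ)
    (hγunit : ∀ i, (γ i).1 ^ 2 + (γ i).2 ^ 2 = 1)
    (hγdist : Function.Injective γ)
    (n : ℝ × ℝ) (hn : n.1 ^ 2 + n.2 ^ 2 = 1)
    (hhalf : ∀ i, dot (γ i) n < 0) :
    ∃ ψ : ℝ × ℝ, ψ.1 ^ 2 + ψ.2 ^ 2 = 1 ∧
      ∑ j, ∏ i ∈ Finset.univ.erase j, dot ψ (γ i) = 0 := by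
  classical
  -- value at n is positive
  have hpos : 0 ≤ ∑ j, ∏ i ∈ Finset.univ.erase j, dot n (γ i) := by
    refine Finset.sum_nonneg fun j _ => ?_
    have h : ∏ i ∈ Finset.univ.erase j, dot n (γ i)
        = ∏ i ∈ Finset.univ.erase j, (-1) * (-dot n (γ i)) :=
      Finset.prod_congr rfl fun i _ => by ring
    rw [h, Finset.prod_mul_distrib, Finset.prod_const, Finset.card_erase_of_mem (Finset.mem_univ j),
      Finset.card_univ, Fintype.card_fin, Nat.add_sub_cancel, pow_mul]
    norm_num
    refine Finset.prod_nonneg fun i _ => ?_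
    have := hhalf i
    simp only [dot] at *
    linarith
  set s : Fin (2 * k + 1) → ℝ := fun i => ((γ i).2 * n.1 - (γ i).1 * n.2) / dot (γ i) n with hs
  have hcross : ∀ b i, (γ b).1 * (γ i).2 - (γ b).2 * (γ i).1
      = dot (γ b) n * dot (γ i) n * (s i - s b) := by
    intro b i
    have hb := (hhalf b).ne
    have hi := (hhalf i).ne
    have h1 : s i * dot (γ i) n = (γ i).2 * n.1 - (γ i).1 * n.2 := div_mul_cancel₀ _ hi
    have h2 : s b * dot (γ b) n = (γ b).2 * n.1 - (γ b).1 * n.2 := div_mul_cancel₀ _ hb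
    have : dot (γ b) n * dot (γ i) n * (s i - s b)
        = dot (γ b) n * (s i * dot (γ i) n) - dot (γ i) n * (s b * dot (γ b) n) := by ring
    rw [this, h1, h2]
    simp only [dot]
    linear_combination (-((γ b).1 * (γ i).2 - (γ b).2 * (γ i).1)) * hn
  have hinj : Function.Injective s := by
    intro b i h
    have h0 := hcross b i
    rw [h, sub_self, mul_zero] at h0
    have hb := hhalf b
    have hi := hhalf i
    have ub := hγunit b
    have ui := hγunit i
    apply hγdist
    -- c = inner product of the two vectors
    set c := (γ b).1 * (γ i).1 + (γ b).2 * (γ i).2 with hc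
    have e1 : (γ i).1 = c * (γ b).1 := by
      rw [hc]; linear_combination (-(γ i).1) * ub - (γ b).2 * h0
    have e2 : (γ i).2 = c * (γ b).2 := by
      rw [hc]; linear_combination (-(γ i).2) * ub + (γ b).1 * h0
    have hc2 : c ^ 2 = 1 := by
      rw [e1, e2] at ui
      linear_combination ui - c ^ 2 * ub
    have hd : dot (γ i) n = c * dot (γ b) n := by
      simp only [dot]; rw [e1, e2]; ring
    have hcpos : 0 < c := by
      by_contra hcn
      push Not at hcn
      have := mul_nonneg_of_nonpos_of_nonpos hcn hb.le
      linarith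
    have hc1 : c = 1 := by nlinarith
    rw [hc1, one_mul] at e1 e2
    exact Prod.ext e1.symm e2.symm
  obtain ⟨a, -, ha⟩ := Finset.exists_min_image Finset.univ s ⟨0, Finset.mem_univ _⟩
  have hne : (Finset.univ.erase a).Nonempty := by
    rw [← Finset.card_pos, Finset.card_erase_of_mem (Finset.mem_univ a), Finset.card_univ,
      Fintype.card_fin]
    omega
  obtain ⟨b, hb, hbmin⟩ := Finset.exists_min_image (Finset.univ.erase a) s hne
  have hba : b ≠ a := Finset.ne_of_mem_erase hb
  set p : ℝ × ℝ := (-(γ b).2, (γ b).1) with hp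
  have hpd : ∀ i, dot p (γ i) = dot (γ b) n * dot (γ i) n * (s i - s b) := by
    intro i
    rw [← hcross]; simp only [dot, hp]; ring
  have hneg : ∑ j, ∏ i ∈ Finset.univ.erase j, dot p (γ i) ≤ 0 := by
    rw [Finset.sum_eq_single b]
    · rw [← Finset.mul_prod_erase _ _ (Finset.mem_erase.2 ⟨hba.symm, Finset.mem_univ a⟩)]
      refine mul_nonpos_of_nonpos_of_nonneg ?_ (Finset.prod_nonneg fun i hi => ?_)
      · rw [hpd]
        exact mul_nonpos_of_nonneg_of_nonpos
          (mul_pos_of_neg_of_neg (hhalf _) (hhalf _)).le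
          (sub_nonpos.2 (ha b (Finset.mem_univ _)))
      · rw [hpd]
        refine mul_nonneg (mul_pos_of_neg_of_neg (hhalf _) (hhalf _)).le
          (sub_nonneg.2 (hbmin i ?_))
        exact Finset.mem_erase.2 ⟨Finset.ne_of_mem_erase hi, Finset.mem_univ _⟩
    · intro j _ hj
      refine Finset.prod_eq_zero (Finset.mem_erase.2 ⟨hj.symm, Finset.mem_univ b⟩) ?_
      rw [hpd, sub_self, mul_zero]
    · intro h; exact absurd (Finset.mem_univ b) h
  obtain ⟨t1, h1⟩ := exists_angle n hn
  obtain ⟨t2, h2⟩ := exists_angle p (by simp only [hp]; linarith [hγunit b])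
  rw [h1] at hpos
  rw [h2] at hneg
  have hcont : Continuous fun t : ℝ =>
      ∑ j, ∏ i ∈ Finset.univ.erase j, dot (cos t, sin t) (γ i) := by
    simp only [dot]; fun_prop
  obtain ⟨t, ht⟩ := mem_range_of_exists_le_of_exists_ge hcont ⟨t2, hneg⟩ ⟨t1, hpos⟩
  exact ⟨(cos t, sin t), Real.cos_sq_add_sin_sq t, ht⟩
end

section
/- Let m = 2k+1 with k ≥ 1 and let γ_j = (cos(2πj/m), sin(2πj/m)) for j = 1, …, m be the ray directions of the regular star with m rays. Then the regular star transform (with uniform weights c_1 = … = c_m = 1) has no singular direction of Type 2: for every unit vector ψ ∈ ℝ², ∑_{j=1}^m ∏_{i≠j} ⟨ψ, γ_i⟩ ≠ 0. -/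
open Real

/-- The ray directions of the regular star with `m` rays:
`γ j = (cos (2πj/m), sin (2πj/m))`, `j = 1, …, m`. -/
noncomputable def regularRay (m : ℕ) (j : Fin m) : ℝ × ℝ :=
  (Real.cos (2 * Real.pi * ((j : ℕ) + 1) / m),
   Real.sin (2 * Real.pi * ((j : ℕ) + 1) / m))

theorem star_prod_identity (m : ℕ) (hm : 0 < m) (ψ : ℝ × ℝ) (hψ : ψ.1 ^ 2 + ψ.2 ^ 2 = 1) :
    ∃ C : ℝ, ∀ φ : ℝ, 2 ^ m * ∏ j : Fin m, (Real.cos φ - dot ψ (regularRay m j))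
      = 2 * Real.cos (m * φ) - C := by
  obtain ⟨z, hz⟩ : ∃ z : ℂ, z = ψ.1 + ψ.2 * Complex.I := ⟨_, rfl⟩
  obtain ⟨u, hu⟩ : ∃ u : ℂ, u = ψ.1 - ψ.2 * Complex.I := ⟨_, rfl⟩
  have hψ' : (ψ.1 : ℂ) ^ 2 + (ψ.2 : ℂ) ^ 2 = 1 := by exact_mod_cast hψ
  have hzu : z * u = 1 := by
    rw [hz, hu]; linear_combination hψ' - (ψ.2 : ℂ) ^ 2 * Complex.I_sq
  have hprim := Complex.isPrimitiveRoot_exp m hm.ne'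
  obtain ⟨ζ, hζ⟩ : ∃ ζ : ℂ, ζ = Complex.exp (2 * π * Complex.I / m) := ⟨_, rfl⟩
  rw [← hζ] at hprim
  have hζ0 : ζ ≠ 0 := by rw [hζ]; exact Complex.exp_ne_zero _
  have key : ∀ (ξ : ℂ), IsPrimitiveRoot ξ m → ∀ w a : ℂ,
      ∏ j : Fin m, (w - a * ξ ^ ((j : ℕ) + 1)) = w ^ m - a ^ m := by
    intro ξ hξ w a
    have h := X_pow_sub_C_eq_prod (a := a ^ m) (α := a * ξ) hξ hm
      (by rw [mul_pow, hξ.pow_eq_one, mul_one])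
    have h2 := congrArg (Polynomial.eval w) h
    simp only [Polynomial.eval_sub, Polynomial.eval_pow, Polynomial.eval_X, Polynomial.eval_C,
      Polynomial.eval_prod] at h2
    rw [h2, Finset.prod_range]
    exact Finset.prod_congr rfl fun j _ => by ring
  have hdot : ∀ j : Fin m, 2 * ((dot ψ (regularRay m j) : ℝ) : ℂ)
      = z * ζ⁻¹ ^ ((j : ℕ) + 1) + u * ζ ^ ((j : ℕ) + 1) := by
    intro j
    have e1 : ζ ^ ((j : ℕ) + 1)
        = Complex.exp (((2 * π * ((j : ℕ) + 1) / m : ℝ) : ℂ) * Complex.I) := by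
      rw [hζ, ← Complex.exp_nat_mul]; congr 1; push_cast; ring
    rw [inv_pow, e1, ← Complex.exp_neg, ← neg_mul, Complex.exp_mul_I, Complex.exp_mul_I,
      Complex.cos_neg, Complex.sin_neg, hz, hu]
    simp only [dot, regularRay, Complex.ofReal_add, Complex.ofReal_mul, Complex.ofReal_cos,
      Complex.ofReal_sin]
    generalize Complex.cos _ = c
    generalize Complex.sin _ = s
    linear_combination (2 * (ψ.2 : ℂ) * s) * Complex.I_sq
  refine ⟨(z ^ m + u ^ m).re, fun φ => ?_⟩
  have hC : (2 ^ m * ∏ j : Fin m, ((Real.cos φ : ℂ) - (dot ψ (regularRay m j) : ℝ)))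
      = 2 * (Real.cos (m * φ) : ℂ) - (z ^ m + u ^ m) := by
    obtain ⟨w, hw⟩ : ∃ w : ℂ, w = Complex.exp (φ * Complex.I) := ⟨_, rfl⟩
    have hw0 : w ≠ 0 := by rw [hw]; exact Complex.exp_ne_zero _
    have hcos : 2 * (Real.cos φ : ℂ) = w + w⁻¹ := by
      rw [hw, ← Complex.exp_neg, Complex.ofReal_cos, Complex.cos, neg_mul]; ring
    have hcosm : 2 * (Real.cos (m * φ) : ℂ) = w ^ m + (w ^ m)⁻¹ := by
      rw [hw, ← Complex.exp_nat_mul, ← Complex.exp_neg, Complex.ofReal_cos, Complex.cos]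
      push_cast
      rw [neg_mul, mul_assoc]; ring
    have hfac : ∀ j : Fin m, w * (2 * ((Real.cos φ : ℂ) - (dot ψ (regularRay m j) : ℝ)))
        = (w - z * ζ⁻¹ ^ ((j : ℕ) + 1)) * (w - u * ζ ^ ((j : ℕ) + 1)) := by
      intro j
      have hp : ζ⁻¹ ^ ((j : ℕ) + 1) * ζ ^ ((j : ℕ) + 1) = 1 := by
        rw [← mul_pow, inv_mul_cancel₀ hζ0, one_pow]
      have hwi : w * w⁻¹ = 1 := mul_inv_cancel₀ hw0
      linear_combination w * hcos - w * hdot j + hwi - z * u * hp - hzu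
    have hprod := Finset.prod_congr (rfl : (Finset.univ : Finset (Fin m)) = _)
      (fun j _ => hfac j)
    rw [Finset.prod_mul_distrib, Finset.prod_mul_distrib, Finset.prod_mul_distrib,
      key _ hprim.inv, key _ hprim] at hprod
    simp only [Finset.prod_const, Finset.card_univ, Fintype.card_fin] at hprod
    have hzum : z ^ m * u ^ m = 1 := by rw [← mul_pow, hzu, one_pow]
    have hwm : w ^ m ≠ 0 := pow_ne_zero _ hw0
    have hwi : w ^ m * (w ^ m)⁻¹ = 1 := mul_inv_cancel₀ hwm
    rw [hcosm]
    apply mul_left_cancel₀ hwm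
    linear_combination hprod + hzum - hwi
  have hre := congrArg Complex.re hC
  have e2 : (2 ^ m * ∏ j : Fin m, ((Real.cos φ : ℂ) - (dot ψ (regularRay m j) : ℝ)))
      = ((2 ^ m * ∏ j : Fin m, (Real.cos φ - dot ψ (regularRay m j)) : ℝ) : ℂ) := by
    push_cast; rfl
  rw [e2, Complex.ofReal_re, Complex.sub_re] at hre
  rw [hre]
  congr 1
  have : (2 * (Real.cos (m * φ) : ℂ)) = ((2 * Real.cos (m * φ) : ℝ) : ℂ) := by push_cast; rfl
  rw [this, Complex.ofReal_re]

theorem regular_odd_star_no_type2_singular_direction (k : ℕ) (hk : 1 ≤ k) :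
    ∀ ψ : ℝ × ℝ, ψ.1 ^ 2 + ψ.2 ^ 2 = 1 →
      ∑ j : Fin (2 * k + 1), ∏ i ∈ Finset.univ.erase j,
        dot ψ (regularRay (2 * k + 1) i) ≠ 0 := by
  intro ψ hψ h0
  obtain ⟨C, hC⟩ := star_prod_identity (2 * k + 1) (by omega) ψ hψ
  have hL : HasDerivAt (fun φ : ℝ => (2 : ℝ) ^ (2 * k + 1) *
      ∏ j : Fin (2 * k + 1), (Real.cos φ - dot ψ (regularRay (2 * k + 1) j))) 0 (π / 2) := by
    have h := (HasDerivAt.fun_finsetProd (u := (Finset.univ : Finset (Fin (2 * k + 1))))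
      (f := fun j φ => Real.cos φ - dot ψ (regularRay (2 * k + 1) j))
      (f' := fun _ => -Real.sin (π / 2)) (x := π / 2)
      (fun j _ => (Real.hasDerivAt_cos _).sub_const _)).const_mul ((2 : ℝ) ^ (2 * k + 1))
    refine HasDerivAt.congr_deriv h ?_
    simp only [Real.cos_pi_div_two, Real.sin_pi_div_two, zero_sub, smul_eq_mul]
    rw [← Finset.sum_mul]
    have : ∀ j : Fin (2 * k + 1), ∏ i ∈ Finset.univ.erase j,
        -dot ψ (regularRay (2 * k + 1) i) = ∏ i ∈ Finset.univ.erase j,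
        dot ψ (regularRay (2 * k + 1) i) := by
      intro j
      rw [Finset.prod_neg]
      simp [Finset.card_erase_of_mem]
    simp only [this, h0]
    simp
  have hR : HasDerivAt (fun φ : ℝ => 2 * Real.cos (((2 * k + 1 : ℕ) : ℝ) * φ) - C)
      (2 * (-Real.sin (((2 * k + 1 : ℕ) : ℝ) * (π / 2)) * (((2 * k + 1 : ℕ) : ℝ) * 1))) (π / 2) :=
    ((((hasDerivAt_id (π / 2)).const_mul _).cos).const_mul 2).sub_const C
  rw [funext hC] at hL
  have h1 := hL.unique hR
  have hm : ((2 * k + 1 : ℕ) : ℝ) ≠ 0 := by positivity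
  have hs : Real.sin (((2 * k + 1 : ℕ) : ℝ) * (π / 2)) = (-1) ^ k := by
    have : ((2 * k + 1 : ℕ) : ℝ) * (π / 2) = π / 2 + k * π := by push_cast; ring
    rw [this, Real.sin_add_nat_mul_pi, Real.sin_pi_div_two, mul_one]
  rw [hs] at h1
  have : ((-1 : ℝ)) ^ k ≠ 0 := pow_ne_zero _ (by norm_num)
  have h2 : (2 * (-(-1 : ℝ) ^ k * (((2 * k + 1 : ℕ) : ℝ) * 1))) ≠ 0 :=
    mul_ne_zero two_ne_zero (mul_ne_zero (neg_ne_zero.mpr this) (mul_ne_zero hm one_ne_zero))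
  exact h2 h1.symm
end

section
/- Let m = 2k+1 with k ≥ 1 and let γ_j = (cos(2πj/m), sin(2πj/m)) for j = 1, …, m be the ray directions of the regular star with m rays. Then the function ψ ↦ ∑_{j=1}^m ∏_{i≠j} ⟨ψ, γ_i⟩ is equal to a nonzero constant on the unit circle: there exists C ∈ ℝ, C ≠ 0, such that ∑_{j=1}^m ∏_{i≠j} ⟨ψ, γ_i⟩ = C for every unit vector ψ ∈ ℝ². -/
open Real

lemma prod_root_aux {m : ℕ} (hm : 0 < m) {ζ : ℂ} (h : IsPrimitiveRoot ζ m) (w z : ℂ) :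
    ∏ j : Fin m, (w - ζ ^ ((j : ℕ) + 1) * z) = w ^ m - z ^ m := by
  have h1 := h.pow_sub_pow_eq_prod_sub_mul w (ζ * z) hm
  rw [mul_pow, h.pow_eq_one, one_mul] at h1
  rw [h1]
  refine Finset.prod_bij (fun (j : Fin m) _ => ζ ^ (j : ℕ)) ?_ ?_ ?_ ?_
  · intro j _
    rw [Polynomial.mem_nthRootsFinset hm, ← pow_mul, mul_comm, pow_mul, h.pow_eq_one, one_pow]
  · intro i _ j _ hij
    exact Fin.ext (h.pow_inj i.2 j.2 hij)
  · intro b hb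
    rw [Polynomial.mem_nthRootsFinset hm] at hb
    have : NeZero m := ⟨hm.ne'⟩
    obtain ⟨i, hi, rfl⟩ := h.eq_pow_of_pow_eq_one hb
    exact ⟨⟨i, hi⟩, Finset.mem_univ _, rfl⟩
  · intro j _
    ring

lemma two_cos_sub (a b : ℂ) : 2 * (Complex.cos a - Complex.cos b) =
    (Complex.exp (a * Complex.I) - Complex.exp (b * Complex.I)) *
      (1 - Complex.exp (-a * Complex.I) * Complex.exp (-b * Complex.I)) := by
  have ha : Complex.exp (a * Complex.I) * Complex.exp (-a * Complex.I) = 1 := by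
    rw [← Complex.exp_add]; simp
  have hb : Complex.exp (b * Complex.I) * Complex.exp (-b * Complex.I) = 1 := by
    rw [← Complex.exp_add]; simp
  unfold Complex.cos
  linear_combination Complex.exp (-b * Complex.I) * ha - Complex.exp (-a * Complex.I) * hb

lemma prod_cos_complex {m : ℕ} (hm : 0 < m) (a t : ℂ) :
    ∏ j : Fin m, (2 * (Complex.cos a - Complex.cos (t - 2 * π * ((j : ℕ) + 1) / m))) =
      2 * (Complex.cos (m * a) - Complex.cos (m * t)) := by
  have h := Complex.isPrimitiveRoot_exp m hm.ne'
  have hm' : (m : ℂ) ≠ 0 := by exact_mod_cast hm.ne'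
  rw [two_cos_sub]
  simp only [two_cos_sub]
  rw [Finset.prod_mul_distrib]
  have e1 : ∀ j : Fin m, Complex.exp ((t - 2 * π * ((j : ℕ) + 1) / m) * Complex.I) =
      ((Complex.exp (2 * π * Complex.I / m))⁻¹) ^ ((j : ℕ) + 1) * Complex.exp (t * Complex.I) := by
    intro j
    rw [← Complex.exp_neg, ← Complex.exp_nat_mul, ← Complex.exp_add]
    congr 1
    push_cast
    ring
  have e2 : ∀ j : Fin m, Complex.exp (-a * Complex.I) *
      Complex.exp (-(t - 2 * π * ((j : ℕ) + 1) / m) * Complex.I) =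
      (Complex.exp (2 * π * Complex.I / m)) ^ ((j : ℕ) + 1) *
        (Complex.exp (-a * Complex.I) * Complex.exp (-t * Complex.I)) := by
    intro j
    rw [← Complex.exp_nat_mul, ← Complex.exp_add, ← Complex.exp_add, ← Complex.exp_add]
    congr 1
    push_cast
    ring
  simp only [e1, e2]
  rw [prod_root_aux hm h.inv, prod_root_aux hm h, one_pow, mul_pow]
  simp only [← Complex.exp_nat_mul]
  congr 2 <;> ring_nf

lemma prod_cos_real {m : ℕ} (hm : 0 < m) (a t : ℝ) :
    ∏ j : Fin m, (cos a - cos (t - 2 * π * ((j : ℕ) + 1) / m)) =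
      2 / 2 ^ m * (cos (m * a) - cos (m * t)) := by
  have h := prod_cos_complex hm a t
  rw [Finset.prod_mul_distrib] at h
  simp only [Finset.prod_const, Finset.card_univ, Fintype.card_fin] at h
  have h' : (2 : ℝ) ^ m * ∏ j : Fin m, (cos a - cos (t - 2 * π * ((j : ℕ) + 1) / m)) =
      2 * (cos (m * a) - cos (m * t)) := by exact_mod_cast h
  rw [div_mul_eq_mul_div, eq_div_iff (by positivity), mul_comm, h']

theorem regular_odd_star_polynomial_constant (k : ℕ) (hk : 1 ≤ k) :
    ∃ C : ℝ, C ≠ 0 ∧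
      ∀ ψ : ℝ × ℝ, ψ.1 ^ 2 + ψ.2 ^ 2 = 1 →
        ∑ j : Fin (2 * k + 1), ∏ i ∈ Finset.univ.erase j,
          dot ψ (regularRay (2 * k + 1) i) = C := by
  have hs : sin (((2 * k + 1 : ℕ) : ℝ) * (π / 2)) = (-1) ^ k := by
    have : ((2 * k + 1 : ℕ) : ℝ) * (π / 2) = π / 2 + k * π := by push_cast; ring
    rw [this, sin_add_nat_mul_pi]; simp
  refine ⟨2 / 2 ^ (2 * k + 1) * ((2 * k + 1 : ℕ) * (-1) ^ k), by positivity, ?_⟩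
  rintro ⟨x, y⟩ hxy
  obtain ⟨t, rfl, rfl⟩ : ∃ t : ℝ, x = cos t ∧ y = sin t := by
    have hz : ‖(⟨x, y⟩ : ℂ)‖ = 1 := by
      rw [← sq_eq_sq₀ (norm_nonneg _) zero_le_one, Complex.sq_norm, Complex.normSq_mk]
      simp only at hxy
      linarith
    refine ⟨Complex.arg ⟨x, y⟩, ?_, ?_⟩
    · rw [Complex.cos_arg (by intro h; simp [h] at hz), hz]; simp
    · rw [Complex.sin_arg, hz]; simp
  have hd : ∀ i : Fin (2 * k + 1), dot (cos t, sin t) (regularRay (2 * k + 1) i) =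
      cos (t - 2 * π * ((i : ℕ) + 1) / (2 * k + 1 : ℕ)) := by
    intro i
    rw [cos_sub]; rfl
  simp only [hd]
  generalize hm : 2 * k + 1 = m at *
  have hev : Even (m - 1) := ⟨k, by omega⟩
  have d1 : HasDerivAt (fun a => ∏ j : Fin m, (cos a - cos (t - 2 * π * ((j : ℕ) + 1) / m)))
      (∑ j : Fin m, (∏ i ∈ Finset.univ.erase j,
        (cos (π / 2) - cos (t - 2 * π * ((i : ℕ) + 1) / m))) • (-sin (π / 2))) (π / 2) :=
    HasDerivAt.fun_finsetProd (fun j _ => (hasDerivAt_cos _).sub_const _)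
  have d2 : HasDerivAt (fun a : ℝ => 2 / 2 ^ m * (cos (m * a) - cos (m * t)))
      (2 / 2 ^ m * (-sin (m * (π / 2)) * (m * 1))) (π / 2) :=
    ((((hasDerivAt_id (π / 2)).const_mul (m : ℝ)).cos).sub_const _).const_mul _
  have he : (fun a => ∏ j : Fin m, (cos a - cos (t - 2 * π * ((j : ℕ) + 1) / m))) =
      (fun a : ℝ => 2 / 2 ^ m * (cos (m * a) - cos (m * t))) :=
    funext fun a => prod_cos_real (by omega) a t
  rw [he] at d1
  have hu := d1.unique d2
  rw [hs] at hu
  simp only [cos_pi_div_two, sin_pi_div_two, zero_sub, Finset.prod_neg, smul_eq_mul,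
    Finset.card_erase_of_mem (Finset.mem_univ _), Finset.card_univ, Fintype.card_fin,
    hev.neg_one_pow, one_mul, mul_neg, mul_one, Finset.sum_neg_distrib] at hu
  linarith
end

section
/- Let m = 2k+1 with k ≥ 1 and let a, b ∈ ℝ^m be the aperture vectors of the regular star with m rays, i.e., a_j = cos(2πj/m) and b_j = sin(2πj/m) for j = 1,…,m. Then there exists a polynomial P₁ with real coefficients in one variable, of degree at most m−1, such that for every α ∈ ℝ, e_{m−1}(cos α · a + sin α · b) = P₁(cos α), where e_{m−1}(y_1,…,y_m) = ∑_{i=1}^m ∏_{j≠i} y_j. -/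
open Real

lemma star_prod_aux {ι : Type*} [DecidableEq ι] (a b : ι → ℝ) (S : Finset ι) :
    ∃ p q : Polynomial ℝ, p.natDegree ≤ S.card ∧ q.natDegree ≤ S.card ∧
      (Polynomial.X * q).natDegree ≤ S.card ∧
      ∀ α : ℝ, ∏ j ∈ S, (Real.cos α * a j + Real.sin α * b j) =
        p.eval (Real.cos α) + Real.sin α * q.eval (Real.cos α) := by
  induction S using Finset.induction_on with
  | empty => exact ⟨1, 0, by simp, by simp, by simp, by simp⟩
  | insert i S hi ih =>
    obtain ⟨p, q, hp, hq, hXq, h⟩ := ih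
    have hX : (Polynomial.X : Polynomial ℝ).natDegree ≤ 1 := Polynomial.natDegree_X_le
    have hC : ∀ (r : Polynomial ℝ) (n : ℕ) (c : ℝ), r.natDegree ≤ n →
        (Polynomial.C c * r).natDegree ≤ n := fun r n c hr =>
      (Polynomial.natDegree_C_mul_le c r).trans hr
    have hXm : ∀ (r : Polynomial ℝ) (n : ℕ), r.natDegree ≤ n →
        (Polynomial.X * r).natDegree ≤ n + 1 := fun r n hr => by
      refine Polynomial.natDegree_mul_le.trans ?_
      omega
    refine ⟨Polynomial.C (a i) * (Polynomial.X * p) + (Polynomial.C (b i) * q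
        - Polynomial.C (b i) * (Polynomial.X * (Polynomial.X * q))),
      Polynomial.C (b i) * p + Polynomial.C (a i) * (Polynomial.X * q), ?_, ?_, ?_, ?_⟩
    · rw [Finset.card_insert_of_notMem hi]
      refine Polynomial.natDegree_add_le_of_degree_le (hC _ _ _ (hXm _ _ hp)) ?_
      exact Polynomial.natDegree_sub_le_of_le (hC _ _ _ (hq.trans (Nat.le_succ _)))
        (hC _ _ _ (hXm _ _ hXq)) |>.trans (by simp)
    · rw [Finset.card_insert_of_notMem hi]
      exact (Polynomial.natDegree_add_le_of_degree_le (hC _ _ _ hp) (hC _ _ _ hXq)).trans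
        (Nat.le_succ _)
    · rw [Finset.card_insert_of_notMem hi]
      exact hXm _ _ (Polynomial.natDegree_add_le_of_degree_le (hC _ _ _ hp) (hC _ _ _ hXq))
    · intro α
      rw [Finset.prod_insert hi, h]
      simp only [Polynomial.eval_add, Polynomial.eval_sub, Polynomial.eval_mul,
        Polynomial.eval_C, Polynomial.eval_X]
      linear_combination (b i * Polynomial.eval (Real.cos α) q) * Real.sin_sq_add_cos_sq α

lemma star_perm_aux (k : ℕ) (a b : Fin (2 * k + 1) → ℝ)
    (ha : ∀ j, a j = Real.cos (2 * Real.pi * ((j : ℕ) + 1) / (2 * k + 1)))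
    (hb : ∀ j, b j = Real.sin (2 * Real.pi * ((j : ℕ) + 1) / (2 * k + 1))) :
    ∃ σ : Equiv.Perm (Fin (2 * k + 1)), ∀ j, a (σ j) = a j ∧ b (σ j) = - b j := by
  have hm : (2 * (k : ℝ) + 1) ≠ 0 := by positivity
  let f : Fin (2 * k + 1) → Fin (2 * k + 1) := fun j =>
    ⟨if (j : ℕ) = 2 * k then 2 * k else 2 * k - 1 - j, by split_ifs <;> omega⟩
  have hf : Function.Involutive f := by
    intro j
    have := j.2
    apply Fin.ext
    simp only [f]
    split_ifs <;> omega
  refine ⟨hf.toPerm, fun j => ?_⟩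
  rw [Function.Involutive.coe_toPerm]
  by_cases hj : (j : ℕ) = 2 * k
  · have h1 : f j = j := Fin.ext (by simp [f, hj])
    have h2 : 2 * Real.pi * (((j : ℕ) : ℝ) + 1) / (2 * k + 1) = 2 * Real.pi := by
      rw [hj]; push_cast; field_simp
    rw [h1]
    refine ⟨rfl, ?_⟩
    rw [hb, h2]; simp
  · have h1 : (((f j : Fin (2 * k + 1)) : ℕ) : ℝ) = 2 * k - 1 - (j : ℕ) := by
      have h3 : ((f j : Fin (2 * k + 1)) : ℕ) + 1 + j = 2 * k := by
        have := j.2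
        simp only [f, hj, if_false]
        omega
      have h4 : (((f j : Fin (2 * k + 1)) : ℕ) : ℝ) + 1 + (j : ℕ) = 2 * k := by exact_mod_cast h3
      linarith
    have h2 : 2 * Real.pi * ((((f j : Fin (2 * k + 1)) : ℕ) : ℝ) + 1) / (2 * k + 1)
        = 2 * Real.pi - 2 * Real.pi * (((j : ℕ) : ℝ) + 1) / (2 * k + 1) := by
      rw [h1]; field_simp; ring
    rw [ha, ha, hb, hb, h2, Real.cos_two_pi_sub, Real.sin_two_pi_sub]
    exact ⟨rfl, rfl⟩

theorem regular_star_polynomial_in_cos (k : ℕ) (hk : 1 ≤ k)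
    (a b : Fin (2 * k + 1) → ℝ)
    (ha : ∀ j, a j = Real.cos (2 * Real.pi * ((j : ℕ) + 1) / (2 * k + 1)))
    (hb : ∀ j, b j = Real.sin (2 * Real.pi * ((j : ℕ) + 1) / (2 * k + 1))) :
    ∃ P : Polynomial ℝ, P.natDegree ≤ 2 * k + 1 - 1 ∧
      ∀ α : ℝ,
        ∑ i : Fin (2 * k + 1), ∏ j ∈ Finset.univ.erase i,
          (Real.cos α * a j + Real.sin α * b j) = P.eval (Real.cos α) := by
  obtain ⟨σ, hσ⟩ := star_perm_aux k a b ha hb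
  choose p q hp _ _ h using fun i : Fin (2 * k + 1) => star_prod_aux a b (Finset.univ.erase i)
  refine ⟨∑ i, p i, ?_, fun α => ?_⟩
  · refine Polynomial.natDegree_sum_le_of_forall_le _ _ fun i _ => ?_
    simpa using hp i
  · have hsym : ∑ i : Fin (2 * k + 1), ∏ j ∈ Finset.univ.erase i,
          (Real.cos α * a j + Real.sin α * b j) =
        ∑ i : Fin (2 * k + 1), ∏ j ∈ Finset.univ.erase i,
          (Real.cos (-α) * a j + Real.sin (-α) * b j) := by
      symm
      refine Fintype.sum_equiv σ _ _ fun i => ?_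
      refine Finset.prod_equiv σ (by simp) fun j _ => ?_
      rw [(hσ j).1, (hσ j).2, Real.cos_neg, Real.sin_neg]
      ring
    have h1 := hsym
    simp only [h] at h1
    simp only [Real.cos_neg, Real.sin_neg, Finset.sum_add_distrib, ← Finset.mul_sum] at h1
    simp only [h, Finset.sum_add_distrib, ← Finset.mul_sum, Polynomial.eval_finsetSum]
    linarith
end

section
/- Let c_1, c_2, c_3 be arbitrary nonzero reals. Then there exist distinct unit vectors γ_1, γ_2, γ_3 in ℝ² such that the star transform with rays γ_1, γ_2, γ_3 and weights c_1, c_2, c_3 contains no singular direction of Type 2: for every unit vector ψ ∈ ℝ², c_1⟨ψ,γ_2⟩⟨ψ,γ_3⟩ + c_2⟨ψ,γ_1⟩⟨ψ,γ_3⟩ + c_3⟨ψ,γ_1⟩⟨ψ,γ_2⟩ ≠ 0. -/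
open Real

/-- Strong form: the rays are pairwise linearly independent. -/
def StrongStar (c₁ c₂ c₃ : ℝ) : Prop :=
  ∃ a₁ b₁ a₂ b₂ a₃ b₃ : ℝ,
    a₁ ^ 2 + b₁ ^ 2 = 1 ∧ a₂ ^ 2 + b₂ ^ 2 = 1 ∧ a₃ ^ 2 + b₃ ^ 2 = 1 ∧
    a₁ * b₂ - a₂ * b₁ ≠ 0 ∧ a₁ * b₃ - a₃ * b₁ ≠ 0 ∧ a₂ * b₃ - a₃ * b₂ ≠ 0 ∧
    ∀ u v : ℝ, u ^ 2 + v ^ 2 = 1 →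
      c₁ * ((u * a₂ + v * b₂) * (u * a₃ + v * b₃)) +
      c₂ * ((u * a₁ + v * b₁) * (u * a₃ + v * b₃)) +
      c₃ * ((u * a₁ + v * b₁) * (u * a₂ + v * b₂)) ≠ 0

lemma StrongStar.swap12 {c₁ c₂ c₃ : ℝ} (h : StrongStar c₁ c₂ c₃) : StrongStar c₂ c₁ c₃ := by
  obtain ⟨a₁, b₁, a₂, b₂, a₃, b₃, h1, h2, h3, h12, h13, h23, h⟩ := h
  refine ⟨a₂, b₂, a₁, b₁, a₃, b₃, h2, h1, h3, ?_, h23, h13, ?_⟩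
  · intro e; apply h12; linarith
  · intro u v huv e; apply h u v huv; linarith

lemma StrongStar.swap23 {c₁ c₂ c₃ : ℝ} (h : StrongStar c₁ c₂ c₃) : StrongStar c₁ c₃ c₂ := by
  obtain ⟨a₁, b₁, a₂, b₂, a₃, b₃, h1, h2, h3, h12, h13, h23, h⟩ := h
  refine ⟨a₁, b₁, a₃, b₃, a₂, b₂, h1, h3, h2, h13, h12, ?_, ?_⟩
  · intro e; apply h23; linarith
  · intro u v huv e; apply h u v huv; linarith

lemma StrongStar.neg1 {c₁ c₂ c₃ : ℝ} (h : StrongStar c₁ c₂ c₃) : StrongStar (-c₁) c₂ c₃ := by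
  obtain ⟨a₁, b₁, a₂, b₂, a₃, b₃, h1, h2, h3, h12, h13, h23, h⟩ := h
  refine ⟨-a₁, -b₁, a₂, b₂, a₃, b₃, by simpa using h1, h2, h3, ?_, ?_, h23, ?_⟩
  · intro e; apply h12; linarith
  · intro e; apply h13; linarith
  · intro u v huv e; apply h u v huv; linarith

lemma StrongStar.abs1 {c₁ c₂ c₃ : ℝ} (h : StrongStar |c₁| c₂ c₃) : StrongStar c₁ c₂ c₃ := by
  rcases abs_choice c₁ with e | e
  · rwa [e] at h
  · rw [e] at h; simpa using h.neg1

lemma strongStar_sorted {c₁ c₂ c₃ : ℝ} (h3 : 0 < c₃) (h32 : c₃ ≤ c₂) (h21 : c₂ ≤ c₁) :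
    StrongStar c₁ c₂ c₃ := by
  have h2 : 0 < c₂ := by linarith
  have h1 : 0 < c₁ := by linarith
  obtain ⟨x, hx⟩ : ∃ x, x = c₂ / c₁ := ⟨_, rfl⟩
  have hx0 : 0 < x := by rw [hx]; positivity
  have hx1 : x ≤ 1 := by rw [hx]; exact (div_le_one h1).2 h21
  have hcx : c₁ * x = c₂ := by rw [hx]; field_simp
  have hpos : 0 < 1 - x ^ 2 / 4 := by nlinarith
  obtain ⟨s, hs⟩ : ∃ s, s = Real.sqrt (1 - x ^ 2 / 4) := ⟨_, rfl⟩
  have hs0 : 0 < s := by rw [hs]; exact Real.sqrt_pos.2 hpos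
  have hs2 : s ^ 2 = 1 - x ^ 2 / 4 := by rw [hs]; exact Real.sq_sqrt hpos.le
  have hxs : 0 < x * s := by positivity
  refine ⟨1, 0, -x / 2, s, -x / 2, -s, by norm_num, by linarith, by linarith,
    by intro e; linarith, by intro e; linarith, by intro e; linarith, ?_⟩
  intro u v huv e
  -- multiply by `-4 c₁` and complete the square
  have key : (2 * c₁ * (s * v) + (c₂ - c₃) * u) ^ 2 + c₃ * (4 * c₂ - c₃) * u ^ 2 = 0 := by
    subst hcx
    linear_combination (-4 * c₁) * e
  have hk : 0 < c₃ * (4 * c₂ - c₃) := mul_pos h3 (by linarith)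
  have hu2 : u ^ 2 = 0 := by
    have := sq_nonneg (2 * c₁ * (s * v) + (c₂ - c₃) * u)
    nlinarith [sq_nonneg u]
  have hu : u = 0 := by simpa using hu2
  subst hu
  have hv : v ≠ 0 := by rintro rfl; norm_num at huv
  have : (2 * c₁ * (s * v)) ≠ 0 := by positivity
  apply this
  simpa using key

lemma strongStar_pos {c₁ c₂ c₃ : ℝ} (h1 : 0 < c₁) (h2 : 0 < c₂) (h3 : 0 < c₃) :
    StrongStar c₁ c₂ c₃ := by
  rcases le_total c₁ c₂ with h12 | h12 <;> rcases le_total c₂ c₃ with h23 | h23 <;>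
    rcases le_total c₁ c₃ with h13 | h13
  · exact (strongStar_sorted h1 h12 h23).swap12.swap23.swap12
  · exact (strongStar_sorted h1 h12 h23).swap12.swap23.swap12
  · exact (strongStar_sorted h1 h13 h23).swap23.swap12
  · exact (strongStar_sorted h3 h13 h12).swap12
  · exact (strongStar_sorted h2 h12 h13).swap12.swap23
  · exact (strongStar_sorted h2 h23 h13).swap23
  · exact (strongStar_sorted h3 h23 h12)
  · exact (strongStar_sorted h3 h23 h12)

theorem exists_three_ray_star_without_type2_singular_direction
    (c₁ c₂ c₃ : ℝ) (hc₁ : c₁ ≠ 0) (hc₂ : c₂ ≠ 0) (hc₃ : c₃ ≠ 0) :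
    ∃ γ₁ γ₂ γ₃ : ℝ × ℝ,
      γ₁.1 ^ 2 + γ₁.2 ^ 2 = 1 ∧ γ₂.1 ^ 2 + γ₂.2 ^ 2 = 1 ∧ γ₃.1 ^ 2 + γ₃.2 ^ 2 = 1 ∧
      γ₁ ≠ γ₂ ∧ γ₁ ≠ γ₃ ∧ γ₂ ≠ γ₃ ∧
      ∀ ψ : ℝ × ℝ, ψ.1 ^ 2 + ψ.2 ^ 2 = 1 →
        c₁ * (dot ψ γ₂ * dot ψ γ₃) + c₂ * (dot ψ γ₁ * dot ψ γ₃) +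
          c₃ * (dot ψ γ₁ * dot ψ γ₂) ≠ 0 := by
  have h : StrongStar c₁ c₂ c₃ := by
    have h0 := strongStar_pos (abs_pos.2 hc₁) (abs_pos.2 hc₂) (abs_pos.2 hc₃)
    exact h0.abs1.swap12.abs1.swap12.swap23.swap12.abs1.swap12.swap23
  obtain ⟨a₁, b₁, a₂, b₂, a₃, b₃, h1, h2, h3, h12, h13, h23, h⟩ := h
  refine ⟨(a₁, b₁), (a₂, b₂), (a₃, b₃), h1, h2, h3, ?_, ?_, ?_, ?_⟩
  · intro e; rw [Prod.mk.injEq] at e; apply h12; rw [e.1, e.2]; ring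
  · intro e; rw [Prod.mk.injEq] at e; apply h13; rw [e.1, e.2]; ring
  · intro e; rw [Prod.mk.injEq] at e; apply h23; rw [e.1, e.2]; ring
  · rintro ⟨u, v⟩ huv
    exact h u v huv
end

section
/- Let c_1, c_2, c_3 > 0 and let W = diag(c_1, c_2, c_3). Then there exist two-dimensional subspaces T_1, T_2 of ℝ³, each spanned by a pair of star aperture vectors (i.e., T_i = span{a, b} for some a, b ∈ ℝ³ with (a_j, b_j) a unit vector in ℝ² for each j = 1, 2, 3), such that T_2 = W^{-1} T_1 and, for i = 1, 2, every nonzero y = (y_1, y_2, y_3) ∈ T_i satisfies e_2(y) = y_1 y_2 + y_1 y_3 + y_2 y_3 ≠ 0. -/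
/-- The elementary symmetric polynomial of degree 2 in 3 variables. -/
def e2 (y : Fin 3 → ℝ) : ℝ := y 0 * y 1 + y 0 * y 2 + y 1 * y 2

/-- A plane (subspace) of ℝ³ is spannable by star aperture vectors (SSAV) if it is
spanned by vectors `a, b ∈ ℝ³` such that `(a j, b j)` is a unit vector in ℝ²
for each `j`. -/
def IsSSAV (T : Submodule ℝ (Fin 3 → ℝ)) : Prop :=
  ∃ a b : Fin 3 → ℝ, (∀ j, (a j) ^ 2 + (b j) ^ 2 = 1) ∧
    T = Submodule.span ℝ {a, b}

/-- The functional `y ↦ n · y`. -/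
noncomputable def nform (n : Fin 3 → ℝ) : (Fin 3 → ℝ) →ₗ[ℝ] ℝ :=
  n 0 • LinearMap.proj 0 + n 1 • LinearMap.proj 1 + n 2 • LinearMap.proj 2

lemma nform_apply (n y : Fin 3 → ℝ) : nform n y = n 0 * y 0 + n 1 * y 1 + n 2 * y 2 := by
  simp [nform]

/-- Strict triangle. -/
def Tri (n : Fin 3 → ℝ) : Prop :=
  (∀ i, 0 < n i) ∧ n 0 < n 1 + n 2 ∧ n 1 < n 0 + n 2 ∧ n 2 < n 0 + n 1

lemma tri_finrank {n : Fin 3 → ℝ} (h : Tri n) :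
    Module.finrank ℝ (LinearMap.ker (nform n)) = 2 := by
  have hne : nform n ≠ 0 := by
    intro h0
    have h1 : nform n ![1, 0, 0] = 0 := by rw [h0]; rfl
    rw [nform_apply] at h1
    have := h.1 0
    simp at h1
    linarith
  have := Module.Dual.finrank_ker_add_one_of_ne_zero (f := nform n) hne
  simp at this
  omega

lemma tri_ssav {n : Fin 3 → ℝ} (h : Tri n) : IsSSAV (LinearMap.ker (nform n)) := by
  obtain ⟨hp, h0, h1, h2⟩ := h
  have p0 := hp 0
  have p1 := hp 1
  have p2 := hp 2
  obtain ⟨p, hpd⟩ : ∃ p, p = ((n 1)^2 - (n 0)^2 - (n 2)^2) / (2 * n 0 * n 2) := ⟨_, rfl⟩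
  have hpe : p * (2 * n 0 * n 2) = (n 1)^2 - (n 0)^2 - (n 2)^2 := by
    rw [hpd]; field_simp
  have hlt : p < 1 := by
    rw [hpd, div_lt_one (by positivity)]
    nlinarith
  have hgt : -1 < p := by
    rw [hpd, lt_div_iff₀ (by positivity)]
    nlinarith
  have hq2 : 0 < 1 - p^2 := by nlinarith
  obtain ⟨q, hq, hqq⟩ : ∃ q : ℝ, 0 < q ∧ q^2 = 1 - p^2 :=
    ⟨√(1 - p^2), Real.sqrt_pos.2 hq2, Real.sq_sqrt hq2.le⟩
  refine ⟨![p, -(n 2 + n 0 * p) / n 1, 1], ![q, -(n 0 * q) / n 1, 0], ?_, ?_⟩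
  · intro j
    fin_cases j
    · simp; linarith
    · simp
      field_simp
      linear_combination (n 0)^2 * hqq + hpe
    · simp
  · ext y
    rw [LinearMap.mem_ker, nform_apply, Submodule.mem_span_pair]
    constructor
    · intro hy
      refine ⟨y 2, (y 0 - y 2 * p) / q, ?_⟩
      ext j
      fin_cases j
      · simp; field_simp; ring
      · simp; field_simp; linear_combination -hy
      · simp
    · rintro ⟨a, b, rfl⟩
      simp
      field_simp
      ring

lemma tri_e2 {n : Fin 3 → ℝ} (h : Tri n) :
    ∀ y ∈ LinearMap.ker (nform n), y ≠ 0 → e2 y ≠ 0 := by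
  obtain ⟨hp, h0, h1, h2⟩ := h
  have p0 := hp 0
  have p1 := hp 1
  have p2 := hp 2
  intro y hy hy0 he
  rw [LinearMap.mem_ker, nform_apply] at hy
  unfold e2 at he
  apply hy0
  -- the quadratic form n2 * e2 on the plane
  have hD : 0 < 2 * (n 0 * n 1 + n 0 * n 2 + n 1 * n 2) - (n 0)^2 - (n 1)^2 - (n 2)^2 := by
    nlinarith [mul_pos p0 (sub_pos.2 h0), mul_pos p1 (sub_pos.2 h1), mul_pos p2 (sub_pos.2 h2)]
  have key : n 0 * (y 0)^2 + (n 0 + n 1 - n 2) * (y 0 * y 1) + n 1 * (y 1)^2 = 0 := by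
    linear_combination (y 0 + y 1) * hy - n 2 * he
  have key2 : (2 * n 0 * y 0 + (n 0 + n 1 - n 2) * y 1)^2 +
    (2 * (n 0 * n 1 + n 0 * n 2 + n 1 * n 2) - (n 0)^2 - (n 1)^2 - (n 2)^2) * (y 1)^2 = 0 := by
    linear_combination 4 * n 0 * key
  have y1 : y 1 = 0 := by
    by_contra hne
    have : 0 < (y 1)^2 := by positivity
    nlinarith [mul_pos hD this, sq_nonneg (2 * n 0 * y 0 + (n 0 + n 1 - n 2) * y 1)]
  have y0 : y 0 = 0 := by
    rw [y1] at key
    simpa [p0.ne'] using key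
  have y2 : y 2 = 0 := by
    rw [y0, y1] at hy
    simpa [p2.ne'] using hy
  ext j
  fin_cases j <;> simp [y0, y1, y2]

lemma exists_tri (c : Fin 3 → ℝ) (hc : ∀ i, 0 < c i) :
    ∃ n : Fin 3 → ℝ, Tri n ∧ Tri (fun i => c i * n i) := by
  have p0 := hc 0
  have p1 := hc 1
  have p2 := hc 2
  have q01 := mul_pos p0 p1
  have q02 := mul_pos p0 p2
  have q12 := mul_pos p1 p2
  have fin : ∀ n : Fin 3 → ℝ, (0 < n 0 ∧ 0 < n 1 ∧ 0 < n 2) →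
      (n 0 < n 1 + n 2 ∧ n 1 < n 0 + n 2 ∧ n 2 < n 0 + n 1) →
      (c 0 * n 0 < c 1 * n 1 + c 2 * n 2 ∧ c 1 * n 1 < c 0 * n 0 + c 2 * n 2 ∧
        c 2 * n 2 < c 0 * n 0 + c 1 * n 1) →
      ∃ n : Fin 3 → ℝ, Tri n ∧ Tri (fun i => c i * n i) := by
    intro n hn h1 h2
    have hn' : ∀ i, 0 < n i := by
      intro i
      fin_cases i
      exacts [hn.1, hn.2.1, hn.2.2]
    exact ⟨n, ⟨hn', h1⟩, fun i => mul_pos (hc i) (hn' i), h2⟩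
  -- largest index gets the middle value, the other two the largest value
  rcases le_total (c 0) (c 1) with h01 | h01 <;> rcases le_total (c 0) (c 2) with h02 | h02 <;>
    rcases le_total (c 1) (c 2) with h12 | h12
  · apply fin ![c 2, c 2, c 1] <;> refine ⟨?_, ?_, ?_⟩ <;> simp <;> nlinarith
  · apply fin ![c 1, c 2, c 1] <;> refine ⟨?_, ?_, ?_⟩ <;> simp <;> nlinarith
  · apply fin ![c 1, c 0, c 1] <;> refine ⟨?_, ?_, ?_⟩ <;> simp <;> nlinarith
  · apply fin ![c 1, c 0, c 1] <;> refine ⟨?_, ?_, ?_⟩ <;> simp <;> nlinarith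
  · apply fin ![c 2, c 2, c 0] <;> refine ⟨?_, ?_, ?_⟩ <;> simp <;> nlinarith
  · apply fin ![c 2, c 2, c 0] <;> refine ⟨?_, ?_, ?_⟩ <;> simp <;> nlinarith
  · apply fin ![c 2, c 0, c 0] <;> refine ⟨?_, ?_, ?_⟩ <;> simp <;> nlinarith
  · apply fin ![c 1, c 0, c 0] <;> refine ⟨?_, ?_, ?_⟩ <;> simp <;> nlinarith

theorem exists_SSAV_planes_avoiding_e2_zero_set
    (c : Fin 3 → ℝ) (hc : ∀ i, 0 < c i) :
    ∃ T₁ T₂ : Submodule ℝ (Fin 3 → ℝ),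
      Module.finrank ℝ T₁ = 2 ∧ Module.finrank ℝ T₂ = 2 ∧
      IsSSAV T₁ ∧ IsSSAV T₂ ∧
      T₂ = T₁.map (LinearMap.pi fun i => (c i)⁻¹ • LinearMap.proj i) ∧
      (∀ y ∈ T₁, y ≠ 0 → e2 y ≠ 0) ∧
      (∀ y ∈ T₂, y ≠ 0 → e2 y ≠ 0) := by
  obtain ⟨n, h1, h2⟩ := exists_tri c hc
  refine ⟨LinearMap.ker (nform n), LinearMap.ker (nform fun i => c i * n i), tri_finrank h1,
    tri_finrank h2, tri_ssav h1, tri_ssav h2, ?_, tri_e2 h1, tri_e2 h2⟩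
  have hne : ∀ i, c i ≠ 0 := fun i => (hc i).ne'
  ext y
  rw [Submodule.mem_map]
  constructor
  · intro hy
    rw [LinearMap.mem_ker, nform_apply] at hy
    refine ⟨fun i => c i * y i, ?_, ?_⟩
    · rw [LinearMap.mem_ker, nform_apply]
      linear_combination hy
    · ext i
      simp [hne i]
  · rintro ⟨x, hx, rfl⟩
    rw [LinearMap.mem_ker, nform_apply] at hx ⊢
    have e : ∀ i, c i * n i * ((c i)⁻¹ * x i) = n i * x i := by
      intro i
      have := hne i
      field_simp
    simp [e]
    exact hx
end

section
/- Let m = 2k+1 for some k ∈ ℕ, k ≥ 1, and let e_{m−1}(y_1,…,y_m) = ∑_{i=1}^m ∏_{j≠i} y_j be the elementary symmetric polynomial of degree m−1 in m variables. Then the zero set e_{m−1}^{-1}(0) ⊆ ℝ^m contains no real vector subspace of dimension m−1: for every subspace V ⊆ ℝ^m with dim V = m−1, there exists y ∈ V with e_{m−1}(y) ≠ 0. -/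
theorem exists_erase_card_ne_one (k : ℕ) (S : Finset (Fin (2 * k + 1))) :
    ∃ i, (S.erase i).card ≠ 1 := by
  by_contra! h
  by_cases hS : S = Finset.univ
  · have h0 := h 0
    rw [hS, Finset.card_erase_of_mem (Finset.mem_univ _), Finset.card_univ, Fintype.card_fin] at h0
    omega
  · obtain ⟨i, hi⟩ : ∃ i, i ∉ S := by
      by_contra! h'
      exact hS (Finset.eq_univ_iff_forall.2 h')
    have h1 := h i
    rw [Finset.erase_eq_of_notMem hi] at h1
    obtain ⟨j, hj⟩ := Finset.card_pos.1 (by omega : 0 < S.card)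
    have h2 := h j
    rw [Finset.card_erase_of_mem hj] at h2
    omega

theorem exists_one_zero (n : ℕ) (a : Fin n → ℝ) (i : Fin n)
    (S : Finset (Fin n)) (hS : ∀ j, j ∈ S ↔ j ≠ i ∧ a j ≠ 0) (hc : S.card ≠ 1) :
    ∃ y : Fin n → ℝ, y i = 0 ∧ (∀ j, j ≠ i → y j ≠ 0) ∧ ∑ j, y j * a j = 0 := by
  classical
  rcases S.eq_empty_or_nonempty with h | ⟨p, hp⟩
  · refine ⟨fun j => if j = i then 0 else 1, by simp, fun j hj => by simp [hj], ?_⟩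
    apply Finset.sum_eq_zero
    intro j _
    by_cases hj : j = i
    · simp [hj]
    · have : a j = 0 := by
        by_contra h'
        have := (hS j).2 ⟨hj, h'⟩
        simp [h] at this
      simp [this]
  · have hpos : 0 < S.card := Finset.card_pos.2 ⟨p, hp⟩
    have hp' := (hS p).1 hp
    have hcc : ((S.card : ℝ) - 1) ≠ 0 := by
      intro h
      apply hc
      have : (S.card : ℝ) = 1 := by linarith
      exact_mod_cast this
    refine ⟨fun j => if j = i then 0 else if a j = 0 then 1 else
      if j = p then -((S.card : ℝ) - 1) / a j else 1 / a j, by simp, ?_, ?_⟩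
    · intro j hj
      simp only [hj, if_false]
      split_ifs with h1 h2
      · exact one_ne_zero
      · exact div_ne_zero (neg_ne_zero.2 hcc) h1
      · exact one_div_ne_zero h1
    · rw [← Finset.sum_subset (Finset.subset_univ S)]
      · rw [← Finset.add_sum_erase S _ hp]
        have : ∀ j ∈ S.erase p, (if j = i then 0 else if a j = 0 then 1 else
            if j = p then -((S.card : ℝ) - 1) / a j else 1 / a j) * a j = 1 := by
          intro j hj
          obtain ⟨h1, h2⟩ := Finset.mem_erase.1 hj
          obtain ⟨h3, h4⟩ := (hS j).1 h2
          simp [h1, h3, h4]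
        rw [Finset.sum_congr rfl this, Finset.sum_const, Finset.card_erase_of_mem hp]
        simp only [hp'.1, hp'.2, if_false, if_true, nsmul_eq_mul, mul_one]
        rw [Nat.cast_sub hpos, div_mul_cancel₀ _ hp'.2]
        simp
      · intro j _ hj
        by_cases h1 : j = i
        · simp [h1]
        · have : a j = 0 := by
            by_contra h'
            exact hj ((hS j).2 ⟨h1, h'⟩)
          simp [this]

theorem zero_set_of_odd_elementary_symmetric_contains_no_hyperplane
    (k : ℕ) (V : Submodule ℝ (Fin (2 * k + 1) → ℝ))
    (hV : Module.finrank ℝ V = 2 * k + 1 - 1) :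
    ∃ y ∈ V, ∑ i, ∏ j ∈ Finset.univ.erase i, y j ≠ 0 := by
  classical
  have hlt : V < ⊤ := by
    apply lt_top_iff_ne_top.2
    rintro rfl
    rw [finrank_top, Module.finrank_fin_fun] at hV
    omega
  obtain ⟨f, hf, hle⟩ := Submodule.exists_le_ker_of_lt_top V hlt
  have hker := Module.Dual.finrank_ker_add_one_of_ne_zero hf
  rw [Module.finrank_fin_fun] at hker
  have hVf : V = LinearMap.ker f :=
    Submodule.eq_of_le_of_finrank_eq hle (by omega)
  let a : Fin (2 * k + 1) → ℝ := fun j => f (fun l => if j = l then 1 else 0)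
  obtain ⟨i, hi⟩ := exists_erase_card_ne_one k (Finset.univ.filter fun j => a j ≠ 0)
  obtain ⟨y, hy0, hy1, hy2⟩ := exists_one_zero _ a i _ (by intro j; simp) hi
  refine ⟨y, ?_, ?_⟩
  · rw [hVf, LinearMap.mem_ker, LinearMap.pi_apply_eq_sum_univ f y]
    simpa [a] using hy2
  · rw [Finset.sum_eq_single i]
    · exact Finset.prod_ne_zero_iff.2 fun j hj => hy1 j (Finset.ne_of_mem_erase hj)
    · intro l _ hl
      exact Finset.prod_eq_zero (Finset.mem_erase.2 ⟨hl.symm, Finset.mem_univ i⟩) hy0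
    · simp
end
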